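/- arXiv:1701.00927 — 3 statements merged into one kernel-verified Lean document; each statement's English description precedes it below -/
import Mathlib

section
/- For every simple odd multi-cactus G and all integers a and b, the graph G does not have the {a,b}-property. -/
open scoped Classical

/-- The weighted degree of vertex `v` under edge-weighting `w`:
the sum of the weights of the edges incident with `v`. -/
noncomputable def wdeg {V : Type} [Fintype V] (G : SimpleGraph V) (w : Sym2 V → ℕ) (v : V) : ℕ :=
  ∑ u ∈ Finset.univ.filter (fun u => G.Adj v u), w s(v, u)

/-- `w` is a `{0,1}`-weighting of `G`: every edge gets weight `0` or `1`. -/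
def Is01Weighting {V : Type} (G : SimpleGraph V) (w : Sym2 V → ℕ) : Prop :=
  ∀ e ∈ G.edgeSet, w e = 0 ∨ w e = 1

/-- `G` has the `{0,1}`-property: it admits a proper (neighbour sum-distinguishing)
`{0,1}`-edge-weighting. A graph without this property is called *bad*. -/
def HasZeroOneProperty {V : Type} [Fintype V] (G : SimpleGraph V) : Prop :=
  ∃ w : Sym2 V → ℕ, Is01Weighting G w ∧
    ∀ ⦃u v : V⦄, G.Adj u v → wdeg G w u ≠ wdeg G w v
/-- Integer-valued weighted degree. -/
noncomputable def wdegZ {V : Type} [Fintype V] (G : SimpleGraph V) (w : Sym2 V → ℤ) (v : V) : ℤ :=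
  ∑ u ∈ Finset.univ.filter (fun u => G.Adj v u), w s(v, u)

/-- `G` has the `{a,b}`-property: there is an edge-weighting with values in `{a,b}` under
which adjacent vertices get distinct weighted degrees. -/
def HasABProperty {V : Type} [Fintype V] (G : SimpleGraph V) (a b : ℤ) : Prop :=
  ∃ w : Sym2 V → ℤ, (∀ e ∈ G.edgeSet, w e = a ∨ w e = b) ∧
    ∀ ⦃u v : V⦄, G.Adj u v → wdegZ G w u ≠ wdegZ G w v
/-- The `i`-th vertex of a path from `u` to `v` with `n` fresh internal vertices. -/
def pathVert {V : Type} (u v : V) (n : ℕ) (i : Fin (n + 2)) : V ⊕ Fin n :=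
  if h0 : i.1 = 0 then Sum.inl u
  else if hn : i.1 ≤ n then Sum.inr ⟨i.1 - 1, by omega⟩
  else Sum.inl v

/-- The edges of a path of length `n + 1` from `u` to `v` with `n` fresh internal vertices. -/
def pathEdges {V : Type} (u v : V) (n : ℕ) : Set (Sym2 (V ⊕ Fin n)) :=
  {e | ∃ i : Fin (n + 1), e = s(pathVert u v n i.castSucc, pathVert u v n i.succ)}

/-- The green edges of such a path, coloured alternately red, green, …, green, red
(so the `i`-th edge is green exactly when `i` is odd). -/
def greenPathEdges {V : Type} (u v : V) (n : ℕ) : Set (Sym2 (V ⊕ Fin n)) :=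
  {e | ∃ i : Fin (n + 1), Odd i.1 ∧ e = s(pathVert u v n i.castSucc, pathVert u v n i.succ)}

/-- The graph obtained from `G` by adding a path of length `n + 1` from `u` to `v`,
internally disjoint from `G` (its `n` internal vertices are fresh). -/
def addPathGraph {V : Type} (G : SimpleGraph V) (u v : V) (n : ℕ) :
    SimpleGraph (V ⊕ Fin n) :=
  SimpleGraph.fromEdgeSet ((Sym2.map Sum.inl '' G.edgeSet) ∪ pathEdges u v n)

/-- The recursion building simple odd multi-cacti together with their red-green
edge-colouring (given by the set of green edges): `K₂` with its unique edge green is a simple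
odd multi-cactus, and one may repeatedly add, along a green edge `uv`, a new internally
disjoint path of length `l ≡ 1 [MOD 4]`, `l ≥ 5` (here `l = 4 * k + 5`), whose edges are
coloured alternately red, green, …, green, red. -/
inductive OMC : ∀ (V : Type), SimpleGraph V → Set (Sym2 V) → Prop
  | k2 : OMC (Fin 2) ⊤ ((⊤ : SimpleGraph (Fin 2)).edgeSet)
  | addPath {V : Type} {G : SimpleGraph V} {green : Set (Sym2 V)} (h : OMC V G green)
      (u v : V) (hadj : G.Adj u v) (hgreen : s(u, v) ∈ green) (k : ℕ) :
      OMC (V ⊕ Fin (4 * k + 4)) (addPathGraph G u v (4 * k + 4))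
        (Sym2.map Sum.inl '' green ∪ greenPathEdges u v (4 * k + 4))

/-- `G` is a simple odd multi-cactus: it is isomorphic to a graph produced by the
recursion `OMC`. -/
def IsSimpleOddMultiCactus {V : Type} (G : SimpleGraph V) : Prop :=
  ∃ (W : Type) (H : SimpleGraph W) (green : Set (Sym2 W)),
    OMC W H green ∧ Nonempty (G ≃g H)

section AddPath

variable {V : Type} {G : SimpleGraph V} {u v : V} {n : ℕ}

theorem pathVert_injective (huv : u ≠ v) : Function.Injective (pathVert u v n) := by
  intro i j h
  ext
  unfold pathVert at h
  split_ifs at h <;> simp_all <;> omega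

theorem pathVert_eq_inr (i : Fin (n + 2)) (j : Fin n) (h : i.1 = j.1 + 1) :
    pathVert u v n i = Sum.inr j := by
  have := j.2
  rw [pathVert, dif_neg (by omega), dif_pos (by omega)]
  congr 1
  ext
  simp [h]

theorem eq_of_pathVert_eq_inr {i : Fin (n + 2)} {j : Fin n}
    (h : pathVert u v n i = Sum.inr j) : i.1 = j.1 + 1 := by
  unfold pathVert at h
  split_ifs at h
  cases h
  simp only
  omega

theorem pathVert_eq_inl {i : Fin (n + 2)} {x : V} (h : pathVert u v n i = Sum.inl x) :
    (x = u ∧ i.1 = 0) ∨ (x = v ∧ i.1 = n + 1) := by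
  have := i.2
  unfold pathVert at h
  split_ifs at h with h0
  · exact .inl ⟨(Sum.inl_injective h).symm, h0⟩
  · exact .inr ⟨(Sum.inl_injective h).symm, by omega⟩

theorem addPathGraph_adj {x y : V ⊕ Fin n} (huv : u ≠ v) :
    (addPathGraph G u v n).Adj x y ↔
      (∃ a b, G.Adj a b ∧ x = Sum.inl a ∧ y = Sum.inl b) ∨
      ∃ i : Fin (n + 1), (x = pathVert u v n i.castSucc ∧ y = pathVert u v n i.succ) ∨
        (x = pathVert u v n i.succ ∧ y = pathVert u v n i.castSucc) := by
  simp only [addPathGraph, SimpleGraph.fromEdgeSet_adj, Set.mem_union, pathEdges,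
    Set.mem_ofPred_eq, Sym2.eq_iff]
  constructor
  · rintro ⟨⟨e, he, h⟩ | h, -⟩
    · induction e with | _ a b =>
      rw [Sym2.map_mk, Sym2.eq_iff] at h
      rcases h with ⟨rfl, rfl⟩ | ⟨rfl, rfl⟩
      · exact .inl ⟨a, b, he, rfl, rfl⟩
      · exact .inl ⟨b, a, SimpleGraph.Adj.symm he, rfl, rfl⟩
    · exact .inr h
  · rintro (⟨a, b, h, rfl, rfl⟩ | ⟨i, h⟩)
    · exact ⟨.inl ⟨s(a, b), h, rfl⟩, by simpa using h.ne⟩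
    · refine ⟨.inr ⟨i, h⟩, ?_⟩
      have hne : pathVert u v n i.castSucc ≠ pathVert u v n i.succ := fun he => by
        simpa [Fin.ext_iff] using pathVert_injective huv he
      rcases h with ⟨rfl, rfl⟩ | ⟨rfl, rfl⟩
      · exact hne
      · exact hne.symm

theorem addPathGraph_adj_inl_inl {x y : V} (huv : u ≠ v) (hn : 0 < n) :
    (addPathGraph G u v n).Adj (Sum.inl x) (Sum.inl y) ↔ G.Adj x y := by
  rw [addPathGraph_adj huv]
  constructor
  · rintro (⟨a, b, h, ha, hb⟩ | ⟨i, h⟩)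
    · cases ha; cases hb; exact h
    · exfalso
      have := i.2
      unfold pathVert at h
      split_ifs at h <;> simp_all
  · exact fun h => .inl ⟨x, y, h, rfl, rfl⟩

theorem addPathGraph_adj_inl_inr {x : V} {j : Fin n} (huv : u ≠ v) :
    (addPathGraph G u v n).Adj (Sum.inl x) (Sum.inr j) ↔
      (x = u ∧ j.1 = 0) ∨ (x = v ∧ j.1 + 1 = n) := by
  rw [addPathGraph_adj huv]
  have hj := j.2
  constructor
  · rintro (⟨a, b, h, ha, hb⟩ | ⟨i, h⟩)
    · cases hb
    · rcases h with ⟨hx, hy⟩ | ⟨hx, hy⟩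
      all_goals
        have hy := eq_of_pathVert_eq_inr hy.symm
        have hx := pathVert_eq_inl hx.symm
        simp only [Fin.val_castSucc, Fin.val_succ] at hx hy
        grind
  · rintro (⟨rfl, h⟩ | ⟨rfl, h⟩)
    · exact .inr ⟨⟨0, by omega⟩, .inl ⟨by simp [pathVert],
        (pathVert_eq_inr _ _ (by simp [h])).symm⟩⟩
    · exact .inr ⟨⟨n, by omega⟩, .inr ⟨by simp [pathVert],
        (pathVert_eq_inr _ _ (by simp [h])).symm⟩⟩

theorem addPathGraph_adj_pathVert {m : ℕ} (hm : m < n) {y : V ⊕ Fin n} (huv : u ≠ v) :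
    (addPathGraph G u v n).Adj (pathVert u v n ⟨m + 1, by omega⟩) y ↔
      y = pathVert u v n ⟨m, by omega⟩ ∨ y = pathVert u v n ⟨m + 2, by omega⟩ := by
  rw [addPathGraph_adj huv]
  constructor
  · rintro (⟨a, b, h, ha, hb⟩ | ⟨i, ⟨h, rfl⟩ | ⟨h, rfl⟩⟩)
    · simp [pathVert, show m + 1 ≤ n from hm] at ha
    · have h := pathVert_injective huv h
      right; congr 1; simp [Fin.ext_iff] at h ⊢; omega
    · have h := pathVert_injective huv h
      left; congr 1; simp [Fin.ext_iff] at h ⊢; omega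
  · rintro (rfl | rfl)
    · exact .inr ⟨⟨m, by omega⟩, .inr ⟨rfl, rfl⟩⟩
    · exact .inr ⟨⟨m + 1, by omega⟩, .inl ⟨rfl, rfl⟩⟩

theorem wdegZ_addPathGraph_pathVert [Fintype V] {m : ℕ} (hm : m < n) (huv : u ≠ v)
    (w : Sym2 (V ⊕ Fin n) → ℤ) :
    wdegZ (addPathGraph G u v n) w (pathVert u v n ⟨m + 1, by omega⟩) =
      w s(pathVert u v n ⟨m, by omega⟩, pathVert u v n ⟨m + 1, by omega⟩) +
      w s(pathVert u v n ⟨m + 1, by omega⟩, pathVert u v n ⟨m + 2, by omega⟩) := by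
  have hs : Finset.univ.filter
      (fun y => (addPathGraph G u v n).Adj (pathVert u v n ⟨m + 1, by omega⟩) y) =
      {pathVert u v n ⟨m, by omega⟩, pathVert u v n ⟨m + 2, by omega⟩} := by
    ext y
    simp [addPathGraph_adj_pathVert hm huv]
  rw [wdegZ, hs, Finset.sum_pair, Sym2.eq_swap]
  intro h
  simpa using pathVert_injective huv h

theorem wdegZ_addPathGraph_inl [Fintype V] (huv : u ≠ v) (hn : 0 < n)
    (w : Sym2 (V ⊕ Fin n) → ℤ) (x : V) :
    wdegZ (addPathGraph G u v n) w (Sum.inl x) = wdegZ G (w ∘ Sym2.map Sum.inl) x +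
      ((if x = u then w s(Sum.inl u, Sum.inr ⟨0, hn⟩) else 0) +
       (if x = v then w s(Sum.inl v, Sum.inr ⟨n - 1, by omega⟩) else 0)) := by
  simp only [wdegZ, Finset.sum_filter, Fintype.sum_sum_type, addPathGraph_adj_inl_inl huv hn,
    addPathGraph_adj_inl_inr huv, Function.comp_apply, Sym2.map_mk]
  congr 1
  rcases eq_or_ne x u with rfl | hu
  · rw [Finset.sum_eq_single ⟨0, hn⟩] <;> simp +contextual [huv, Fin.ext_iff]
  rcases eq_or_ne x v with rfl | hv
  · rw [Finset.sum_eq_single ⟨n - 1, by omega⟩]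
    · simp [hu, Nat.sub_add_cancel hn]
    · intro j _ hj
      rw [if_neg]
      simp only [ne_eq, Fin.ext_iff] at hj
      simp [hu]
      omega
    · simp
  · simp [hu, hv]

/-- If the ends of every green edge of the new path have distinct weighted degrees, then the
two end edges of that path have the same weight. -/
theorem addPathGraph_end_weights_eq [Fintype V] {k : ℕ} (huv : u ≠ v) {a b : ℤ}
    (w : Sym2 (V ⊕ Fin (4 * k + 4)) → ℤ)
    (hw : ∀ e ∈ (addPathGraph G u v (4 * k + 4)).edgeSet, w e = a ∨ w e = b)
    (hne : ∀ x y, s(x, y) ∈ greenPathEdges u v (4 * k + 4) →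
      wdegZ (addPathGraph G u v (4 * k + 4)) w x ≠ wdegZ (addPathGraph G u v (4 * k + 4)) w y) :
    w s(Sum.inl u, Sum.inr ⟨0, by omega⟩) = w s(Sum.inl v, Sum.inr ⟨4 * k + 4 - 1, by omega⟩) := by
  let f : Fin (4 * k + 5) → ℤ := fun i =>
    w s(pathVert u v (4 * k + 4) i.castSucc, pathVert u v (4 * k + 4) i.succ)
  have hf : ∀ i, f i = a ∨ f i = b := fun i =>
    hw _ ((addPathGraph_adj huv).2 (.inr ⟨i, .inl ⟨rfl, rfl⟩⟩))
  have hstep : ∀ m (hm : m + 2 < 4 * k + 5), Even m →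
      f ⟨m, by omega⟩ ≠ f ⟨m + 2, hm⟩ := by
    intro m hm hme h
    refine hne _ _ ⟨⟨m + 1, by omega⟩, hme.add_one, rfl⟩ ?_
    have h1 := wdegZ_addPathGraph_pathVert (G := G) (m := m) (by omega) huv w
    have h2 := wdegZ_addPathGraph_pathVert (G := G) (m := m + 1) (by omega) huv w
    refine h1.trans (Eq.trans ?_ h2.symm)
    rw [add_comm]
    exact congrArg _ h
  have hall : ∀ j (hj : 4 * j < 4 * k + 5), f ⟨4 * j, hj⟩ = f ⟨0, by omega⟩ := by
    intro j
    induction j with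
    | zero => intro _; rfl
    | succ j ih =>
      intro hj
      rw [← ih (by omega)]
      have h1 := hstep (4 * j) (by omega) ⟨2 * j, by ring⟩
      have h2 := hstep (4 * j + 2) (by omega) ⟨2 * j + 1, by ring⟩
      have h0 := hf ⟨4 * j, by omega⟩
      have h3 := hf ⟨4 * j + 2, by omega⟩
      have h4 := hf ⟨4 * (j + 1), hj⟩
      change f ⟨4 * j + 2, _⟩ ≠ f ⟨4 * (j + 1), hj⟩ at h2
      grind
  have := hall (k + 1) (by omega)
  have e0 : f ⟨0, by omega⟩ = w s(Sum.inl u, Sum.inr ⟨0, by omega⟩) := by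
    simp [f, pathVert]
  have e1 : f ⟨4 * (k + 1), by omega⟩ =
      w s(Sum.inl v, Sum.inr ⟨4 * k + 4 - 1, by omega⟩) := by
    rw [Sym2.eq_swap]
    simp [f, pathVert, show 4 * (k + 1) = 4 * k + 4 by ring]
  rw [← e0, ← e1, this]

end AddPath

namespace OMC

theorem green_subset {V : Type} {G : SimpleGraph V} {green : Set (Sym2 V)} (h : OMC V G green) :
    green ⊆ G.edgeSet := by
  induction h with
  | k2 => exact subset_rfl
  | @addPath V G green h u v hadj hgreen k ih =>
    rintro e (⟨e, he, rfl⟩ | ⟨i, -, rfl⟩)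
    · induction e with | _ x y =>
      exact (addPathGraph_adj hadj.ne).2 (.inl ⟨x, y, ih he, rfl, rfl⟩)
    · exact (addPathGraph_adj hadj.ne).2 (.inr ⟨i, .inl ⟨rfl, rfl⟩⟩)

/-- The green edges form a matching. -/
theorem green_matching {V : Type} {G : SimpleGraph V} {green : Set (Sym2 V)} (h : OMC V G green)
    {x y z : V} (hy : s(x, y) ∈ green) (hz : s(x, z) ∈ green) : y = z := by
  induction h with
  | k2 =>
    rw [SimpleGraph.mem_edgeSet, SimpleGraph.top_adj] at hy hz
    omega
  | @addPath V G green h u v hadj hgreen k ih =>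
    have hinl : ∀ {p q : V ⊕ Fin (4 * k + 4)}, s(p, q) ∈ Sym2.map Sum.inl '' green →
        ∃ a b, s(a, b) ∈ green ∧ p = Sum.inl a ∧ q = Sum.inl b := by
      rintro p q ⟨e, he, h⟩
      induction e with | _ a b =>
      rw [Sym2.map_mk, Sym2.eq_iff] at h
      rcases h with ⟨rfl, rfl⟩ | ⟨rfl, rfl⟩
      · exact ⟨a, b, he, rfl, rfl⟩
      · exact ⟨b, a, Sym2.eq_swap ▸ he, rfl, rfl⟩
    have hpath : ∀ {p q : V ⊕ Fin (4 * k + 4)}, s(p, q) ∈ greenPathEdges u v (4 * k + 4) →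
        ∃ i j : Fin (4 * k + 4), p = Sum.inr i ∧ q = Sum.inr j ∧
          ((Even i.1 ∧ j.1 = i.1 + 1) ∨ (Even j.1 ∧ i.1 = j.1 + 1)) := by
      rintro p q ⟨i, ⟨m, hm⟩, h⟩
      have hi := i.2
      have h1 : pathVert u v (4 * k + 4) i.castSucc = Sum.inr ⟨2 * m, by omega⟩ :=
        pathVert_eq_inr _ _ (by simp [hm])
      have h2 : pathVert u v (4 * k + 4) i.succ = Sum.inr ⟨2 * m + 1, by omega⟩ :=
        pathVert_eq_inr _ _ (by simp [hm])
      rw [h1, h2, Sym2.eq_iff] at h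
      rcases h with ⟨rfl, rfl⟩ | ⟨rfl, rfl⟩
      · exact ⟨_, _, rfl, rfl, .inl ⟨by simp, rfl⟩⟩
      · exact ⟨_, _, rfl, rfl, .inr ⟨by simp, rfl⟩⟩
    rcases hy with hy | hy <;> rcases hz with hz | hz
    · obtain ⟨a, b, hab, rfl, rfl⟩ := hinl hy
      obtain ⟨c, d, hcd, hc, rfl⟩ := hinl hz
      cases hc
      rw [ih hab hcd]
    · obtain ⟨a, b, hab, rfl, rfl⟩ := hinl hy
      obtain ⟨c, d, hc, -⟩ := hpath hz
      cases hc
    · obtain ⟨a, b, hab, rfl, rfl⟩ := hinl hz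
      obtain ⟨c, d, hc, -⟩ := hpath hy
      cases hc
    · obtain ⟨a, b, rfl, rfl, hab⟩ := hpath hy
      obtain ⟨c, d, hc, rfl, hcd⟩ := hpath hz
      cases hc
      congr 1
      ext
      grind

/-- Every `{a,b}`-edge-weighting gives equal weighted degrees to the ends of some green edge. -/
theorem exists_green_wdegZ_eq {V : Type} {G : SimpleGraph V} {green : Set (Sym2 V)}
    (h : OMC V G green) [inst : Fintype V] {a b : ℤ} (w : Sym2 V → ℤ)
    (hw : ∀ e ∈ G.edgeSet, w e = a ∨ w e = b) :
    ∃ x y, s(x, y) ∈ green ∧ wdegZ G w x = wdegZ G w y := by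
  revert inst w
  induction h with
  | k2 =>
    intro inst w hw
    obtain rfl : inst = Fin.fintype 2 := Subsingleton.elim _ _
    refine ⟨0, 1, by simp, ?_⟩
    simp [wdegZ, Finset.sum_filter, Fin.sum_univ_two, Sym2.eq_swap]
  | @addPath V G green h u v hadj hgreen k ih =>
    intro inst w hw
    have : Fintype V := Fintype.ofInjective (Sum.inl : V → V ⊕ Fin (4 * k + 4)) Sum.inl_injective
    obtain rfl : inst = instFintypeSum V (Fin (4 * k + 4)) := Subsingleton.elim _ _
    by_contra! hne
    have hends := addPathGraph_end_weights_eq hadj.ne w hw fun x y hxy => hne x y (.inr hxy)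
    obtain ⟨x, y, hxy, heq⟩ := ih (w ∘ Sym2.map Sum.inl) fun e he => by
      induction e with | _ x y =>
      exact hw _ ((addPathGraph_adj_inl_inl hadj.ne (by omega)).2 he)
    refine hne (Sum.inl x) (Sum.inl y) (.inl ⟨_, hxy, rfl⟩) ?_
    rw [wdegZ_addPathGraph_inl hadj.ne (by omega), wdegZ_addPathGraph_inl hadj.ne (by omega), heq,
      hends]
    have hvu : s(v, u) ∈ green := Sym2.eq_swap ▸ hgreen
    have hyx : s(y, x) ∈ green := Sym2.eq_swap ▸ hxy
    have hiff : x = u ↔ y = v :=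
      ⟨by rintro rfl; exact h.green_matching hxy hgreen,
        by rintro rfl; exact h.green_matching hyx hvu⟩
    have hiff' : x = v ↔ y = u :=
      ⟨by rintro rfl; exact h.green_matching hxy hvu,
        by rintro rfl; exact h.green_matching hyx hgreen⟩
    simp only [hiff, hiff']
    rw [add_comm (ite (y = v) _ _)]

end OMC

theorem wdegZ_iso {V W : Type} [Fintype V] [Fintype W] {G : SimpleGraph V} {H : SimpleGraph W}
    (f : G ≃g H) (w : Sym2 V → ℤ) (x : W) :
    wdegZ H (w ∘ Sym2.map f.symm) x = wdegZ G w (f.symm x) := by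
  simp only [wdegZ, Finset.sum_filter, Function.comp_apply, Sym2.map_mk]
  refine Fintype.sum_equiv f.symm.toEquiv _ _ fun y => ?_
  have : G.Adj (f.symm x) (f.symm y) ↔ H.Adj x y := f.symm.map_adj_iff
  simp [this]

/-- No simple odd multi-cactus has the `{a,b}`-property, for any
integers `a` and `b`. -/
theorem statement1 {V : Type} [Fintype V] (G : SimpleGraph V)
    (h : IsSimpleOddMultiCactus G) (a b : ℤ) : ¬ HasABProperty G a b := by
  rintro ⟨w, hw, hne⟩
  obtain ⟨W, H, green, hH, ⟨f⟩⟩ := h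
  have : Fintype W := Fintype.ofEquiv V f.toEquiv
  obtain ⟨x, y, hxy, heq⟩ := hH.exists_green_wdegZ_eq (a := a) (b := b) (w ∘ Sym2.map f.symm)
    fun e he => by
      induction e with | _ x y =>
      exact hw _ (f.symm.map_adj_iff.2 he)
  rw [wdegZ_iso, wdegZ_iso] at heq
  exact hne (f.symm.map_adj_iff.2 (hH.green_subset hxy)) heq
end

section
/- Let G be a finite connected bipartite graph with bipartition classes X and Y such that |X| is even, and let a and b be integers of distinct parity. Then G has the {a,b}-property. -/
open scoped Classical

/-- The map sending an edge-weighting to its weighted degrees. -/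
noncomputable def degreeHom {V M : Type} [Fintype V] [AddCommMonoid M] (G : SimpleGraph V) :
    (Sym2 V → M) →+ (V → M) where
  toFun f v := ∑ u ∈ Finset.univ.filter (fun u => G.Adj v u), f s(v, u)
  map_zero' := by ext; simp
  map_add' f g := by ext; simp [Finset.sum_add_distrib]

theorem degreeHom_single {V M : Type} [Fintype V] [AddCommMonoid M] {G : SimpleGraph V} {x y : V}
    (h : G.Adj x y) (m : M) :
    degreeHom G (Pi.single s(x, y) m) = Pi.single x m + Pi.single y m := by
  ext v
  have hne := h.ne
  simp only [degreeHom, AddMonoidHom.coe_mk, ZeroHom.coe_mk, Pi.add_apply]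
  by_cases hx : v = x
  · subst hx
    rw [Finset.sum_eq_single_of_mem y (by simpa using h)]
    · simp [hne]
    · intro u _ hu
      simp [hne, hu]
  by_cases hy : v = y
  · subst hy
    rw [Finset.sum_eq_single_of_mem x (by simpa using h.symm)]
    · simp [hne.symm, Sym2.eq_swap]
    · intro u _ hu
      simp [hne.symm, hu]
  · rw [Pi.single_eq_of_ne hx, Pi.single_eq_of_ne hy, add_zero]
    exact Finset.sum_eq_zero fun u _ => by simp [hx, hy]

theorem single_add_single_mem_range_degreeHom {V : Type} [Fintype V] {G : SimpleGraph V} {x y : V}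
    (p : G.Walk x y) :
    Pi.single x 1 + Pi.single y 1 ∈ (degreeHom (M := ZMod 2) G).range := by
  have hself (v : V) : (Pi.single v 1 + Pi.single v 1 : V → ZMod 2) = 0 := by
    rw [← Pi.single_add, CharTwo.add_self_eq_zero, Pi.single_zero]
  induction p with
  | nil => rw [hself]; exact zero_mem _
  | @cons x y z h p ih =>
    have := add_mem (AddMonoidHom.mem_range.2 ⟨_, degreeHom_single h (1 : ZMod 2)⟩) ih
    rwa [add_assoc, ← add_assoc (Pi.single y 1), hself, zero_add] at this

/-- In a connected graph, every vertex set of even size is the set of vertices of odd degree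
of some set of edges. -/
theorem exists_degreeHom_eq_indicator {V : Type} [Fintype V] {G : SimpleGraph V}
    (hG : G.Connected) (T : Finset V) (hT : Even T.card) :
    ∃ f : Sym2 V → ZMod 2, degreeHom G f = fun v => if v ∈ T then 1 else 0 := by
  obtain ⟨r⟩ := hG.nonempty
  have hmem : ∑ t ∈ T, (Pi.single t 1 + Pi.single r 1) ∈ (degreeHom (M := ZMod 2) G).range :=
    sum_mem fun t _ => single_add_single_mem_range_degreeHom (hG t r).some
  have hsum : ∑ t ∈ T, (Pi.single t 1 + Pi.single r 1 : V → ZMod 2) =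
      fun v => if v ∈ T then 1 else 0 := by
    have h0 : (T.card : ZMod 2) = 0 := (ZMod.natCast_eq_zero_iff_even).2 hT
    ext v
    simp [Finset.sum_apply, Finset.sum_add_distrib, h0, Pi.single_apply]
  rwa [hsum] at hmem

/-- A finite connected bipartite graph, one of whose bipartition classes
has even size, has the `{a,b}`-property for any integers `a, b` of distinct parity. -/
theorem statement6 {V : Type} [Fintype V] (G : SimpleGraph V) (hconn : G.Connected)
    (c : V → Bool) (hc : ∀ ⦃x y : V⦄, G.Adj x y → c x ≠ c y)
    (hX : Even (Finset.univ.filter fun v => c v = true).card)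
    (a b : ℤ) (hab : a % 2 ≠ b % 2) :
    HasABProperty G a b := by
  obtain ⟨f, hf⟩ := exists_degreeHom_eq_indicator hconn _ hX
  have hne : (a : ZMod 2) ≠ b := fun h => hab ((ZMod.intCast_eq_intCast_iff' a b 2).1 h)
  have hcases : ∀ p q z : ZMod 2, p ≠ q → z ≠ p → q = z := by decide
  set w : Sym2 V → ℤ := fun e => if f e = a then a else b with hw
  have hwf (e : Sym2 V) : (w e : ZMod 2) = f e := by
    by_cases h : f e = a
    · simp [hw, h]
    · simpa [hw, h] using hcases _ _ _ hne h
  have hdeg (v : V) : (wdegZ G w v : ZMod 2) = if c v = true then 1 else 0 := by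
    simpa [wdegZ, hwf, degreeHom] using congrFun hf v
  refine ⟨w, fun e _ => ite_eq_or_eq _ _ _, fun u v huv h => ?_⟩
  have huv' := hc huv
  have hcast := (hdeg u).symm.trans ((congrArg _ h).trans (hdeg v))
  cases hu : c u <;> cases hv : c v <;> simp_all
end

section
/- Every finite simple bipartite graph that is 2-connected and 3-edge-connected has both the {0,1}-property and the {1,2}-property. -/
open scoped Classical

open Finset

/-- **Rado's theorem** for finite families of finite sets of vectors. -/
theorem rado_linearIndependent {k W α ι : Type*} [Field k] [AddCommGroup W] [Module k W]
    [FiniteDimensional k W] [Fintype ι] [DecidableEq α] (vec : α → W) (L : ι → Finset α)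
    (h : ∀ Y : Finset ι,
      #Y ≤ Module.finrank k (Submodule.span k (vec '' (Y.biUnion L : Finset α)))) :
    ∃ e : ι → α, (∀ i, e i ∈ L i) ∧ LinearIndependent k (vec ∘ e) := by
  induction hN : ∑ i, #(L i) using Nat.strong_induction_on generalizing L with
  | _ N ih =>
  by_cases hbig : ∃ i, 2 ≤ #(L i)
  · obtain ⟨i, hi⟩ := hbig
    obtain ⟨x, hx, y, hy, hxy⟩ := Finset.one_lt_card.1 hi
    have key : ∀ z ∈ L i, (¬ ∀ Y : Finset ι, #Y ≤ Module.finrank k (Submodule.span k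
        (vec '' (Y.biUnion (Function.update L i ((L i).erase z)) : Finset α)))) →
        ∃ Y : Finset ι, i ∉ Y ∧ Module.finrank k (Submodule.span k
          (vec '' (Y.biUnion L ∪ (L i).erase z : Finset α))) ≤ #Y := by
      intro z hz hne
      push Not at hne
      obtain ⟨Y, hY⟩ := hne
      by_cases hiY : i ∈ Y
      · refine ⟨Y.erase i, by simp, ?_⟩
        have hsub : ((Y.erase i).biUnion L ∪ (L i).erase z : Finset α) =
            Y.biUnion (Function.update L i ((L i).erase z)) := by
          conv_rhs => rw [← Finset.insert_erase hiY]
          rw [Finset.biUnion_insert, Finset.union_comm]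
          congr 1
          · simp
          · refine Finset.biUnion_congr rfl fun j hj => ?_
            rw [Function.update_of_ne (Finset.ne_of_mem_erase hj)]
        rw [hsub, Finset.card_erase_of_mem hiY]
        omega
      · exfalso
        have hsub : Y.biUnion (Function.update L i ((L i).erase z)) = Y.biUnion L := by
          refine Finset.biUnion_congr rfl fun j hj => ?_
          rw [Function.update_of_ne (by rintro rfl; exact hiY hj)]
        rw [hsub] at hY
        exact absurd (h Y) (by omega)
    have red : ∀ z ∈ L i, (∀ Y : Finset ι, #Y ≤ Module.finrank k (Submodule.span k
        (vec '' (Y.biUnion (Function.update L i ((L i).erase z)) : Finset α)))) →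
        ∃ e : ι → α, (∀ i, e i ∈ L i) ∧ LinearIndependent k (vec ∘ e) := by
      intro z hz hY
      have hle : ∀ j, Function.update L i ((L i).erase z) j ⊆ L j := by
        intro j
        by_cases hj : j = i
        · subst hj; simpa using Finset.erase_subset _ _
        · simp [hj]
      obtain ⟨e, he, hl⟩ := ih (∑ j, #(Function.update L i ((L i).erase z) j)) (by
        rw [← hN]
        refine Finset.sum_lt_sum (fun j _ => Finset.card_le_card (hle j)) ⟨i, by simp, ?_⟩
        rw [Function.update_self]
        exact Finset.card_erase_lt_of_mem hz) _ hY rfl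
      exact ⟨e, fun j => hle j (he j), hl⟩
    by_contra hno
    obtain ⟨Y₁, hi₁, h₁⟩ := key x hx fun hc => hno (red x hx hc)
    obtain ⟨Y₂, hi₂, h₂⟩ := key y hy fun hc => hno (red y hy hc)
    set U₁ := Submodule.span k (vec '' (Y₁.biUnion L ∪ (L i).erase x : Finset α))
    set U₂ := Submodule.span k (vec '' (Y₂.biUnion L ∪ (L i).erase y : Finset α))
    have hsup : #(insert i (Y₁ ∪ Y₂)) ≤ Module.finrank k (U₁ ⊔ U₂ : Submodule k W) := by
      refine (h _).trans (Submodule.finrank_mono ?_)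
      rw [← Submodule.span_union, ← Set.image_union]
      refine Submodule.span_mono (Set.image_mono ?_)
      intro a ha
      by_cases hax : a = x
      · subst hax; simp_all
      · simp only [coe_biUnion, coe_insert, coe_union, Set.mem_iUnion, Set.mem_union,
          Set.mem_insert_iff, mem_coe, mem_erase] at ha ⊢
        grind
    have hinf : #(Y₁ ∩ Y₂) ≤ Module.finrank k (U₁ ⊓ U₂ : Submodule k W) := by
      refine (h _).trans (Submodule.finrank_mono (le_inf ?_ ?_)) <;>
      · refine Submodule.span_mono (Set.image_mono ?_)
        intro a ha
        simp only [coe_biUnion, coe_inter, Set.mem_iUnion, Set.mem_inter_iff,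
          mem_coe, coe_union, Set.mem_union] at ha ⊢
        grind
    have := Submodule.finrank_sup_add_finrank_inf_eq U₁ U₂
    have := Finset.card_union_add_card_inter Y₁ Y₂
    rw [Finset.card_insert_of_notMem (by simp [hi₁, hi₂])] at hsup
    omega
  · push Not at hbig
    have hne : ∀ i, (L i).Nonempty := by
      intro i
      by_contra hcon
      rw [Finset.not_nonempty_iff_eq_empty] at hcon
      have := h {i}
      simp [hcon] at this
    choose e he using hne
    refine ⟨e, he, ?_⟩
    rw [linearIndependent_iff_card_le_finrank_span]
    have := h univ
    rw [Finset.card_univ] at this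
    refine this.trans (Submodule.finrank_mono (Submodule.span_mono ?_))
    rintro _ ⟨a, ha, rfl⟩
    obtain ⟨i, -, hi⟩ := Finset.mem_biUnion.1 (Finset.mem_coe.1 ha)
    exact ⟨i, by
      rw [Function.comp_apply, Finset.card_le_one.1 (Nat.le_of_lt_succ (hbig i)) _ (he i) _ hi]⟩

/-- Over `ZMod 2`, a set of edges can be completed to one with prescribed degree parities as soon
as every cut-type obstruction vanishes. -/
theorem exists_edges_with_parities {V : Type*} [Fintype V] (E S : Finset (V × V)) (hS : S ⊆ E)
    (T : V → ZMod 2)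
    (h : ∀ f : V → ZMod 2, (∀ p ∈ E, p ∉ S → f p.1 = f p.2) →
      ∑ u, f u * T u = ∑ p ∈ S, (f p.1 + f p.2)) :
    ∃ R ⊆ E, S ⊆ R ∧ ∀ u,
      ((#{p ∈ R | p.1 = u} + #{p ∈ R | p.2 = u} : ℕ) : ZMod 2) = T u := by
  set b : V × V → V → ZMod 2 := fun p => Pi.single p.1 1 + Pi.single p.2 1 with hb
  set t : V → ZMod 2 := T - ∑ p ∈ S, b p with ht
  have hmem : t ∈ Submodule.span (ZMod 2) (b '' (E \ S : Finset (V × V))) := by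
    by_contra hcon
    obtain ⟨φ, hφ, hker⟩ := Submodule.exists_le_ker_of_notMem hcon
    have hrep : ∀ g : V → ZMod 2, φ g = ∑ u, φ (Pi.single u 1) * g u := by
      intro g
      conv_lhs => rw [pi_eq_sum_univ' g]
      rw [map_sum]
      refine Finset.sum_congr rfl fun u _ => ?_
      rw [map_smul, smul_eq_mul, mul_comm]
    have hbφ : ∀ p, φ (b p) = φ (Pi.single p.1 1) + φ (Pi.single p.2 1) := by
      intro p; simp [hb]
    have := h (fun u => φ (Pi.single u 1)) (by
      intro p hp hpS
      have h0 : φ (b p) = 0 := hker (Submodule.subset_span ⟨p, by simp [hp, hpS], rfl⟩)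
      rw [hbφ] at h0
      exact CharTwo.add_eq_zero.1 h0)
    apply hφ
    rw [ht, map_sub, map_sum, hrep T, this]
    simp [hbφ]
  obtain ⟨c, hc⟩ : ∃ c : V × V → ZMod 2, ∑ p ∈ E \ S, c p • b p = t := by
    exact Submodule.mem_span_image_finset_iff_exists_fun' _ |>.1 hmem
  refine ⟨S ∪ {p ∈ E \ S | c p = 1}, ?_, Finset.subset_union_left, ?_⟩
  · exact Finset.union_subset hS ((Finset.filter_subset _ _).trans Finset.sdiff_subset)
  · intro u
    have hdis : Disjoint S {p ∈ E \ S | c p = 1} := by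
      rw [Finset.disjoint_left]; intro p hp; simp [hp]
    have hcount : ∀ Q : Finset (V × V),
        ((#{p ∈ Q | p.1 = u} + #{p ∈ Q | p.2 = u} : ℕ) : ZMod 2) = (∑ p ∈ Q, b p) u := by
      intro Q
      simp [hb, Finset.sum_apply, Finset.sum_add_distrib, Pi.single_apply, Finset.sum_boole,
        eq_comm]
    rw [hcount, Finset.sum_union hdis]
    have : ∑ p ∈ E \ S with c p = 1, b p = t := by
      rw [← hc, Finset.sum_filter]
      refine Finset.sum_congr rfl fun p _ => ?_
      rcases (by decide : ∀ z : ZMod 2, z = 0 ∨ z = 1) (c p) with h | h <;> simp [h]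
    rw [this, ht]
    simp

/-- Edge cuts have at least three edges in a graph that stays connected after deleting two. -/
theorem three_le_card_cut {V : Type*} [Fintype V] (G : SimpleGraph V)
    (h3edge : ∀ s : Set (Sym2 V), s ⊆ G.edgeSet → s.ncard ≤ 2 →
      (G.deleteEdges s).Connected) (C : Finset V) {a b : V} (ha : a ∈ C) (hb : b ∉ C) :
    3 ≤ #{p : V × V | G.Adj p.1 p.2 ∧ p.1 ∈ C ∧ p.2 ∉ C} := by
  by_contra hlt
  set Q : Finset (V × V) := {p : V × V | G.Adj p.1 p.2 ∧ p.1 ∈ C ∧ p.2 ∉ C} with hQ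
  have hcon := h3edge (Q.image fun p => s(p.1, p.2) : Finset (Sym2 V)) (by
    intro e he
    simp only [coe_image, Set.mem_image, mem_coe] at he
    obtain ⟨p, hp, rfl⟩ := he
    rw [hQ] at hp
    simpa using (Finset.mem_filter.1 hp).2.1) (by
    rw [Set.ncard_coe_finset]
    exact Finset.card_image_le.trans (by omega))
  obtain ⟨p⟩ := hcon.preconnected a b
  obtain ⟨d, -, h1, h2⟩ := p.exists_boundary_dart (C : Set V) (by simpa) (by simpa)
  have hd := d.adj
  rw [SimpleGraph.deleteEdges_adj] at hd
  apply hd.2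
  simp only [coe_image, Set.mem_image, mem_coe]
  exact ⟨(d.fst, d.snd), Finset.mem_filter.2 ⟨mem_univ _, hd.1, by simpa using h1, by simpa using h2⟩,
    rfl⟩

/-- The edges of a bipartite graph with side `A`, oriented away from `A`, that avoid `v ∈ A`. -/
noncomputable def edgesAvoiding {V : Type*} [Fintype V] (G : SimpleGraph V) (A : V → Prop) (v : V) :
    Finset (V × V) :=
  {p | G.Adj p.1 p.2 ∧ A p.1 ∧ p.1 ≠ v}

/-- The coboundary over `ZMod 2` of a function on the vertices, with respect to the edges in `E`. -/
noncomputable def coboundary {V : Type*} (E : Finset (V × V)) :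
    (V → ZMod 2) →ₗ[ZMod 2] (V × V → ZMod 2) where
  toFun f p := if p ∈ E then f p.1 + f p.2 else 0
  map_add' f g := by
    ext p
    by_cases hp : p ∈ E <;> simp [hp]
    ring
  map_smul' c f := by
    ext p
    by_cases hp : p ∈ E <;> simp [hp]
    ring

/-- The class of an edge modulo cuts; a set of edges is independent iff it contains no cut. -/
noncomputable def edgeModCuts {V : Type*} (E : Finset (V × V)) (p : V × V) :
    (V × V → ZMod 2) ⧸ LinearMap.range (coboundary E) :=
  (LinearMap.range (coboundary E)).mkQ (Pi.single p 1)

/-- Edges of the neighbours `Y` of `v` have large rank modulo cuts, with the number `c` of components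
left after deleting `v` and `Y` bounded by counting the edges leaving them. -/
theorem exists_component_bound {V : Type*} [Fintype V] (G : SimpleGraph V) (A : V → Prop) (v : V)
    (hA : ∀ u w, G.Adj u w → (A u ↔ ¬ A w)) (hv : A v)
    (hcut : ∀ (C : Finset V) (a b : V), a ∈ C → b ∉ C →
      3 ≤ #{p : V × V | G.Adj p.1 p.2 ∧ p.1 ∈ C ∧ p.2 ∉ C})
    (Y : Finset V) (hY : ∀ y ∈ Y, G.Adj v y) (hne : Y.Nonempty) :
    ∃ c : ℕ, 3 * c + #Y ≤ #{p ∈ edgesAvoiding G A v | p.2 ∈ Y} + #{y | G.Adj v y} ∧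
      #{p ∈ edgesAvoiding G A v | p.2 ∈ Y} + 1 ≤
        Module.finrank (ZMod 2) (Submodule.span (ZMod 2) (edgeModCuts (edgesAvoiding G A v) ''
          ({p ∈ edgesAvoiding G A v | p.2 ∈ Y} : Finset (V × V)))) + #Y + c := by
  set E := edgesAvoiding G A v with hE
  set EY : Finset (V × V) := {p ∈ E | p.2 ∈ Y} with hEY
  have hEmem : ∀ p, p ∈ E ↔ G.Adj p.1 p.2 ∧ A p.1 ∧ p.1 ≠ v := by
    intro p; simp [hE, edgesAvoiding]
  have hYA : ∀ y ∈ Y, ¬ A y := fun y hy => (hA v y (hY y hy)).1 hv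
  set X := insert v Y with hX
  let H : SimpleGraph V :=
    { Adj := fun a b => G.Adj a b ∧ a ∉ X ∧ b ∉ X
      symm := ⟨fun a b h => ⟨h.1.symm, h.2.2, h.2.1⟩⟩
      loopless := ⟨fun a h => G.loopless.irrefl a h.1⟩ }
  have hisol : ∀ x ∈ X, ∀ u, H.Reachable x u → x = u := by
    rintro x hx u ⟨p⟩
    cases p with
    | nil => rfl
    | cons h _ => exact absurd hx h.2.1
  let mk : V → H.ConnectedComponent := H.connectedComponentMk
  have hmk : ∀ x ∈ X, ∀ u, mk x = mk u → x = u := fun x hx u h =>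
    hisol x hx u (SimpleGraph.ConnectedComponent.exact h)
  set I : Finset H.ConnectedComponent := X.image mk with hI
  refine ⟨#Iᶜ, ?_, ?_⟩
  · set Q : Finset (V × V) := {p | G.Adj p.1 p.2 ∧ p.1 ∉ X ∧ p.2 ∈ X} with hQ
    have h1 : 3 * #Iᶜ ≤ #Q := by
      rw [Finset.card_eq_sum_card_fiberwise (f := fun p : V × V => mk p.1) (s := Q) (t := Iᶜ)]
      · rw [mul_comm, ← smul_eq_mul]
        refine Finset.card_nsmul_le_sum _ _ _ fun K hK => ?_
        obtain ⟨a, rfl⟩ := K.exists_rep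
        have hKX : ∀ x ∈ X, mk x ≠ mk a := by
          intro x hx hxa
          exact Finset.mem_compl.1 hK (Finset.mem_image.2 ⟨x, hx, hxa⟩)
        refine (hcut {u | mk u = mk a} a v (by simp) (by
          simpa using hKX v (Finset.mem_insert_self _ _))).trans (Finset.card_le_card ?_)
        intro p hp
        simp only [mem_filter, mem_univ, true_and] at hp
        have hp1 : p.1 ∉ X := fun h => hKX _ h hp.2.1
        have hp2 : p.2 ∈ X := by
          by_contra hcon
          apply hp.2.2
          rw [← hp.2.1]
          exact (SimpleGraph.ConnectedComponent.sound
            (SimpleGraph.Adj.reachable (G := H) ⟨hp.1, hp1, hcon⟩)).symm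
        simp only [mem_filter, hQ, mem_univ, true_and]
        exact ⟨⟨hp.1, hp1, hp2⟩, hp.2.1⟩
      · intro p hp
        have hp := (Finset.mem_filter.1 hp).2
        simp only [coe_compl, Set.mem_compl_iff, mem_coe, hI, mem_image, not_exists, not_and]
        intro x hx hxp
        exact hp.2.1 (hmk x hx _ hxp ▸ hx)
    have h2 : #Q ≤ #EY + #(({y | G.Adj v y} : Finset V) \ Y) := by
      rw [← Finset.card_map (⟨fun a => (a, v), fun a b h => (Prod.mk.inj h).1⟩ : V ↪ V × V)
        (s := ({y | G.Adj v y} : Finset V) \ Y)]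
      refine (Finset.card_le_card ?_).trans (Finset.card_union_le _ _)
      rintro ⟨a, b⟩ hp
      simp only [hQ, hX, mem_filter, mem_univ, true_and, mem_insert, not_or] at hp
      simp only [mem_union, mem_map, hEY, mem_filter, hEmem,
        mem_sdiff, mem_univ, true_and]
      obtain ⟨hadj, ⟨hav, haY⟩, rfl | hb⟩ := hp
      · exact Or.inr ⟨a, ⟨hadj.symm, haY⟩, rfl⟩
      · exact Or.inl ⟨⟨hadj, (hA _ _ hadj).2 (hYA b hb), hav⟩, hb⟩
    have h3 := Finset.card_sdiff_add_card_eq_card (s := Y) (t := {y | G.Adj v y})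
      (by intro y hy; simpa using hY y hy)
    omega
  · set U : Submodule (ZMod 2) (V × V → ZMod 2) :=
      Submodule.span (ZMod 2) ((fun p => Pi.single p 1) '' (EY : Set (V × V))) with hU
    have hUfin : Module.finrank (ZMod 2) U = #EY := by
      have hli : LinearIndependent (ZMod 2)
          (fun p : EY => (Pi.single (p : V × V) 1 : V × V → ZMod 2)) :=
        (Pi.linearIndependent_single_one (V × V) (ZMod 2)).comp _ Subtype.val_injective
      have := finrank_span_eq_card hli
      rw [hU, Set.image_eq_range]
      simpa using this
    have hUsupp : ∀ g ∈ U, ∀ p ∉ EY, g p = 0 := by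
      intro g hg p hp
      have : U ≤ LinearMap.ker (LinearMap.proj (R := ZMod 2) (φ := fun _ : V × V => ZMod 2) p) := by
        rw [hU, Submodule.span_le]
        rintro _ ⟨q, hq, rfl⟩
        have : p ≠ q := by rintro rfl; exact hp hq
        simp [this]
      exact this hg
    have hrange : LinearMap.range ((LinearMap.range (coboundary E)).mkQ.domRestrict U) =
        Submodule.span (ZMod 2) (edgeModCuts E '' (EY : Set (V × V))) := by
      rw [LinearMap.range_domRestrict, hU, Submodule.map_span, ← Set.image_comp]
      rfl
    have hrk := LinearMap.finrank_range_add_finrank_ker ((LinearMap.range (coboundary E)).mkQ.domRestrict U)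
    rw [hrange, hUfin] at hrk
    let L : (H.ConnectedComponent → ZMod 2) →ₗ[ZMod 2] (V × V → ZMod 2) :=
      coboundary E ∘ₗ LinearMap.funLeft (ZMod 2) (ZMod 2) mk
    have hLapp : ∀ g p, L g p = if p ∈ E then g (mk p.1) + g (mk p.2) else 0 := fun _ _ => rfl
    have hker : Module.finrank (ZMod 2) (LinearMap.ker ((LinearMap.range (coboundary E)).mkQ.domRestrict U)) ≤
        Module.finrank (ZMod 2) (LinearMap.range L) := by
      rw [← Submodule.finrank_map_subtype_eq U]
      refine Submodule.finrank_mono ?_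
      rintro _ ⟨⟨g, hg⟩, hgk, rfl⟩
      have hgW : g ∈ LinearMap.range (coboundary E) := by
        simpa using hgk
      obtain ⟨f, hf⟩ := hgW
      have hconst : ∀ a b, H.Adj a b → f a = f b := by
        have aux : ∀ a b, H.Adj a b → A a → f a = f b := by
          intro a b hab haA
          have hmem : (a, b) ∈ E :=
            (hEmem _).2 ⟨hab.1, haA, fun h => hab.2.1 (Finset.mem_insert.2 (Or.inl h))⟩
          have h0 := hUsupp g hg (a, b) (by
            simp only [hEY, mem_filter, not_and]
            intro _ hb
            exact hab.2.2 (Finset.mem_insert_of_mem hb))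
          rw [← hf] at h0
          simp only [coboundary, LinearMap.coe_mk, AddHom.coe_mk, hmem, if_true] at h0
          exact CharTwo.add_eq_zero.1 h0
        intro a b hab
        by_cases haA : A a
        · exact aux a b hab haA
        · exact (aux b a hab.symm ((hA b a hab.1.symm).2 haA)).symm
      have hwalk : ∀ a b, H.Reachable a b → f a = f b := by
        rintro a b ⟨p⟩
        induction p with
        | nil => rfl
        | cons h _ ih => exact (hconst _ _ h).trans ih
      exact ⟨SimpleGraph.ConnectedComponent.lift f fun a b p _ => hwalk a b ⟨p⟩, hf⟩
    have hLrk := LinearMap.finrank_range_add_finrank_ker L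
    rw [Module.finrank_fintype_fun_eq_card] at hLrk
    have hker2 : 2 ≤ Module.finrank (ZMod 2) (LinearMap.ker L) := by
      obtain ⟨y, hy⟩ := hne
      have hvy : mk v ≠ mk y := fun h =>
        (hY y hy).ne (hmk v (Finset.mem_insert_self _ _) y h)
      have m1 : (fun _ => 1 : H.ConnectedComponent → ZMod 2) ∈ LinearMap.ker L := by
        rw [LinearMap.mem_ker]
        ext p
        rw [hLapp]
        split_ifs
        · exact CharTwo.add_self_eq_zero _
        · rfl
      have m2 : (Pi.single (mk v) 1 : H.ConnectedComponent → ZMod 2) ∈ LinearMap.ker L := by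
        rw [LinearMap.mem_ker]
        ext p
        rw [hLapp]
        split_ifs with hp
        · rw [hEmem] at hp
          have n1 : mk p.1 ≠ mk v := fun h =>
            hp.2.2 (hmk v (Finset.mem_insert_self _ _) _ h.symm).symm
          have n2 : mk p.2 ≠ mk v := fun h => by
            have := hmk v (Finset.mem_insert_self _ _) _ h.symm
            exact (hA _ _ hp.1).1 hp.2.1 (this ▸ hv)
          simp [n1, n2]
        · rfl
      have hli : LinearIndependent (ZMod 2)
          ![(⟨_, m1⟩ : LinearMap.ker L), (⟨_, m2⟩ : LinearMap.ker L)] := by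
        rw [LinearIndependent.pair_iff]
        intro s t hst
        have hst' := congrArg Subtype.val hst
        have e1 := congrFun hst' (mk y)
        have e2 := congrFun hst' (mk v)
        simp [hvy.symm] at e1 e2
        subst e1
        simpa using e2
      simpa using hli.fintype_card_le_finrank
    have hI1 : #I ≤ #Y + 1 := Finset.card_image_le.trans (Finset.card_insert_le _ _)
    have hI2 := Finset.card_add_card_compl I
    have hcc : Fintype.card H.ConnectedComponent = #I + #Iᶜ := hI2.symm
    omega

/-- A function constant along all edges avoiding `v` is constant off `v`. -/
theorem eq_of_forall_edgesAvoiding {V : Type*} [Fintype V] (G : SimpleGraph V) (A : V → Prop)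
    (v : V) (hA : ∀ u w, G.Adj u w → (A u ↔ ¬ A w))
    (hconn : (G.induce {x : V | x ≠ v}).Connected) (f : V → ZMod 2)
    (hf : ∀ p ∈ edgesAvoiding G A v, f p.1 = f p.2) {a b : V} (ha : a ≠ v) (hb : b ≠ v) :
    f a = f b := by
  obtain ⟨p⟩ := hconn.preconnected ⟨a, ha⟩ ⟨b, hb⟩
  have : ∀ x y : {x : V | x ≠ v}, (G.induce {x : V | x ≠ v}).Walk x y → f x = f y := by
    intro x y p
    induction p with
    | nil => rfl
    | @cons x y z h _ ih =>
      refine Eq.trans ?_ ih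
      have hxy : G.Adj x y := h
      by_cases hx : A x
      · exact hf (x, y) (by simpa [edgesAvoiding] using ⟨hxy, hx, x.2⟩)
      · exact (hf (y, x) (by
          simpa [edgesAvoiding] using ⟨hxy.symm, (hA _ _ hxy.symm).2 hx, y.2⟩)).symm
  exact this _ _ p

theorem card_edgesAvoiding_snd_add_one {V : Type*} [Fintype V] (G : SimpleGraph V) (A : V → Prop)
    (v : V) (hA : ∀ u w, G.Adj u w → (A u ↔ ¬ A w)) (hv : A v) {y : V} (hy : G.Adj v y) :
    #{p ∈ edgesAvoiding G A v | p.2 = y} + 1 = #{x | G.Adj y x} := by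
  have : ({p ∈ edgesAvoiding G A v | p.2 = y} : Finset (V × V)) =
      (({x | G.Adj y x} : Finset V).erase v).map
        ⟨fun a => (a, y), fun a b h => (Prod.mk.inj h).1⟩ := by
    ext ⟨a, b⟩
    simp only [edgesAvoiding, mem_filter, mem_univ, true_and, mem_map, mem_erase]
    constructor
    · rintro ⟨⟨h1, -, h3⟩, rfl⟩
      exact ⟨a, ⟨h3, h1.symm⟩, rfl⟩
    · rintro ⟨a, ⟨h1, h2⟩, h⟩
      obtain ⟨rfl, rfl⟩ := Prod.mk.inj h
      exact ⟨⟨h2.symm, (hA _ _ h2.symm).2 ((hA _ _ hy).1 hv), h1⟩, rfl⟩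
  rw [this, Finset.card_map]
  exact Finset.card_erase_add_one (by simpa using hy.symm)

theorem exists_edges_of_not_cubic {V : Type*} [Fintype V] (G : SimpleGraph V) (A : V → Prop) (v : V)
    (hA : ∀ u w, G.Adj u w → (A u ↔ ¬ A w)) (hv : A v)
    (hconn : (G.induce {x : V | x ≠ v}).Connected)
    (hcut : ∀ (C : Finset V) (a b : V), a ∈ C → b ∉ C →
      3 ≤ #{p : V × V | G.Adj p.1 p.2 ∧ p.1 ∈ C ∧ p.2 ∉ C})
    (h3 : 3 ≤ #{x | G.Adj v x})
    (hmin : ∀ y, G.Adj v y → #{x | G.Adj v x} ≤ #{x | G.Adj y x})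
    (hex : #{x | G.Adj v x} = 3 → ∃ y, G.Adj v y ∧ 3 < #{x | G.Adj y x})
    (T : V → ZMod 2) (hTv : T v = 0) (hT : ∑ u, T u = 0) :
    ∃ R ⊆ edgesAvoiding G A v, (∀ y, G.Adj v y → ∃ p ∈ R, p.2 = y) ∧ ∀ u,
      ((#{p ∈ R | p.1 = u} + #{p ∈ R | p.2 = u} : ℕ) : ZMod 2) = T u := by
  set E := edgesAvoiding G A v with hE
  let ι := {y // G.Adj v y}
  let L : ι → Finset (V × V) := fun y => {p ∈ E | p.2 = y}
  obtain ⟨e, heL, hli⟩ := rado_linearIndependent (k := ZMod 2) (edgeModCuts E) L (by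
    intro Y
    rcases Y.eq_empty_or_nonempty with rfl | hYne
    · simp
    set Y' : Finset V := Y.map (Function.Embedding.subtype _) with hY'
    have hY'adj : ∀ y ∈ Y', G.Adj v y := by
      intro y hy
      obtain ⟨z, -, rfl⟩ := Finset.mem_map.1 hy
      exact z.2
    have hcardY : #Y' = #Y := Finset.card_map _
    have hU : Y.biUnion L = {p ∈ E | p.2 ∈ Y'} := by
      ext p
      simp only [L, mem_biUnion, mem_filter, hY', mem_map, Function.Embedding.subtype_apply]
      constructor
      · rintro ⟨y, hy, hp, hpy⟩
        exact ⟨hp, y, hy, hpy.symm⟩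
      · rintro ⟨hp, y, hy, hpy⟩
        exact ⟨y, hy, hp, hpy.symm⟩
    obtain ⟨c, hc1, hc2⟩ := exists_component_bound G A v hA hv hcut Y' hY'adj
      (Finset.map_nonempty.2 hYne)
    have hP : #{p ∈ E | p.2 ∈ Y'} + #Y' = ∑ y ∈ Y', #{x | G.Adj y x} := by
      rw [Finset.card_eq_sum_card_fiberwise (f := Prod.snd) (t := Y')
        (by intro p hp; exact (Finset.mem_filter.1 hp).2), Finset.card_eq_sum_ones Y',
        ← Finset.sum_add_distrib]
      refine Finset.sum_congr rfl fun y hy => ?_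
      rw [← card_edgesAvoiding_snd_add_one G A v hA hv (hY'adj y hy)]
      congr 2
      ext p
      simp only [mem_filter]
      constructor
      · rintro ⟨⟨h1, -⟩, h2⟩; exact ⟨h1, h2⟩
      · rintro ⟨h1, h2⟩; exact ⟨⟨h1, h2 ▸ hy⟩, h2⟩
    have hge : #Y' * #{x | G.Adj v x} ≤ ∑ y ∈ Y', #{x | G.Adj y x} := by
      rw [← smul_eq_mul]
      exact Finset.card_nsmul_le_sum _ _ _ fun y hy => hmin y (hY'adj y hy)
    have hle : #Y' ≤ #{x | G.Adj v x} :=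
      Finset.card_le_card fun y hy => by simpa using hY'adj y hy
    have hpos : 1 ≤ #Y' := by rw [hcardY]; exact hYne.card_pos
    rw [hU, ← hcardY]
    rw [← hE] at hc1 hc2
    rcases Nat.lt_or_ge 3 #{x | G.Adj v x} with h4 | h4
    · have : #Y' * 4 + #{x | G.Adj v x} ≤ #Y' * #{x | G.Adj v x} + 4 := by
        obtain ⟨m, hm⟩ := Nat.exists_eq_add_of_le hpos
        obtain ⟨d, hd⟩ := Nat.exists_eq_add_of_lt h4
        rw [hm, hd]
        nlinarith [Nat.zero_le (m * d)]
      omega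
    · have hd : #{x | G.Adj v x} = 3 := le_antisymm h4 h3
      rw [hd] at hge hle hc1
      have hlt : #Y' = 3 → 9 < ∑ y ∈ Y', #{x | G.Adj y x} := by
        intro h
        obtain ⟨y, hy, hy3⟩ := hex hd
        have hYall : Y' = ({x | G.Adj v x} : Finset V) :=
          Finset.eq_of_subset_of_card_le (fun y hy => by simpa using hY'adj y hy) (by omega)
        have : ∑ y ∈ Y', 3 < ∑ y ∈ Y', #{x | G.Adj y x} :=
          Finset.sum_lt_sum (fun z hz => hd ▸ hmin z (hY'adj z hz))
            ⟨y, by rw [hYall]; simpa using hy, hy3⟩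
        simpa [h] using this
      omega)
  have heE : ∀ i, e i ∈ E := fun i => (Finset.mem_filter.1 (heL i)).1
  have hey : ∀ i, (e i).2 = i := fun i => (Finset.mem_filter.1 (heL i)).2
  have hinj : Function.Injective e := fun i j hij => Subtype.ext (by rw [← hey, ← hey, hij])
  obtain ⟨R, hRE, hSR, hR⟩ := exists_edges_with_parities E (univ.image e)
    (by intro p hp; obtain ⟨i, -, rfl⟩ := Finset.mem_image.1 hp; exact heE i) T (by
    intro f hf
    have hsum : coboundary E f = ∑ i, (f (e i).1 + f (e i).2) • Pi.single (e i) 1 := by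
      ext p
      simp only [coboundary, LinearMap.coe_mk, AddHom.coe_mk, Finset.sum_apply, Pi.smul_apply,
        smul_eq_mul]
      by_cases hpS : ∃ i, e i = p
      · obtain ⟨i, rfl⟩ := hpS
        rw [if_pos (heE i), Finset.sum_eq_single i]
        · simp
        · intro j _ hj
          simp [hinj.ne hj.symm]
        · simp
      · rw [Finset.sum_eq_zero]
        · split_ifs with hp
          · rw [hf p hp (by simpa using hpS), CharTwo.add_self_eq_zero]
          · rfl
        · intro i _
          have : p ≠ e i := fun h => hpS ⟨i, h.symm⟩
          simp [this]
    have hzero : ∑ i, (f (e i).1 + f (e i).2) • (edgeModCuts E ∘ e) i = 0 := by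
      have : (LinearMap.range (coboundary E)).mkQ (coboundary E f) = 0 := by
        rw [Submodule.mkQ_apply, Submodule.Quotient.mk_eq_zero]
        exact ⟨f, rfl⟩
      rw [hsum, map_sum] at this
      simpa [edgeModCuts] using this
    have hcoef := Fintype.linearIndependent_iff.1 hli _ hzero
    have hconst : ∀ p ∈ E, f p.1 = f p.2 := by
      intro p hp
      by_cases hpS : p ∈ univ.image e
      · obtain ⟨i, -, rfl⟩ := Finset.mem_image.1 hpS
        exact CharTwo.add_eq_zero.1 (hcoef i)
      · exact hf p hp hpS
    rw [Finset.sum_image fun i _ j _ h => hinj h, Finset.sum_eq_zero (s := univ) fun i _ => hcoef i]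
    obtain ⟨⟨a, ha⟩⟩ := hconn.nonempty
    calc ∑ u, f u * T u = ∑ u, f a * T u := by
          refine Finset.sum_congr rfl fun u _ => ?_
          by_cases hu : u = v
          · rw [hu, hTv, mul_zero, mul_zero]
          · rw [eq_of_forall_edgesAvoiding G A v hA hconn f hconst hu ha]
      _ = 0 := by rw [← Finset.mul_sum, hT, mul_zero])
  exact ⟨R, hRE, fun y hy => ⟨e ⟨y, hy⟩, hSR (Finset.mem_image_of_mem _ (mem_univ _)), hey _⟩, hR⟩

/-- The ordered pairs of adjacent vertices leaving `C`. -/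
noncomputable def cutPairs {V : Type*} [Fintype V] (G : SimpleGraph V) (C : Finset V) :
    Finset (V × V) :=
  {p | G.Adj p.1 p.2 ∧ p.1 ∈ C ∧ p.2 ∉ C}

/-- A union `C` of components left after deleting `v` and its neighbours that obstructs, by parity,
the choice of all edges at the neighbours of `v`. -/
structure IsParityObstruction {V : Type*} [Fintype V] (G : SimpleGraph V) (A : V → Prop) (v : V)
    (C : Finset V) : Prop where
  notMem : v ∉ C
  not_adj : ∀ u ∈ C, ¬ G.Adj v u
  closed : ∀ u ∈ C, ∀ w, G.Adj u w → w ∈ C ∨ G.Adj v w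
  odd : Odd (#{u ∈ C | A u} + #(cutPairs G C))

theorem exists_edges_of_no_obstruction {V : Type*} [Fintype V] (G : SimpleGraph V) (A : V → Prop)
    (v : V) (hA : ∀ u w, G.Adj u w → (A u ↔ ¬ A w)) (hv : A v) (hcub : ∀ u, #{x | G.Adj u x} = 3)
    (hC : ∀ C, ¬ IsParityObstruction G A v C) :
    ∃ R ⊆ edgesAvoiding G A v, (∀ y, G.Adj v y → ∃ p ∈ R, p.2 = y) ∧ ∀ u,
      ((#{p ∈ R | p.1 = u} + #{p ∈ R | p.2 = u} : ℕ) : ZMod 2) = if A u ∧ u ≠ v then 1 else 0 := by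
  set E := edgesAvoiding G A v with hE
  have hEmem : ∀ p, p ∈ E ↔ G.Adj p.1 p.2 ∧ A p.1 ∧ p.1 ≠ v := by
    intro p; simp [hE, edgesAvoiding]
  set S : Finset (V × V) := {p ∈ E | G.Adj v p.2} with hS
  have hSfib : ∀ y, G.Adj v y → #{p ∈ S | p.2 = y} = 2 := by
    intro y hy
    have h1 := card_edgesAvoiding_snd_add_one G A v hA hv hy
    rw [hcub, ← hE] at h1
    have : ({p ∈ S | p.2 = y} : Finset (V × V)) = {p ∈ E | p.2 = y} := by
      ext p
      simp only [hS, mem_filter]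
      constructor
      · rintro ⟨⟨h1, -⟩, h2⟩; exact ⟨h1, h2⟩
      · rintro ⟨h1, h2⟩; exact ⟨⟨h1, h2 ▸ hy⟩, h2⟩
    rw [this]
    omega
  obtain ⟨R, hRE, hSR, hR⟩ := exists_edges_with_parities E S (Finset.filter_subset _ _)
    (fun u => if A u ∧ u ≠ v then 1 else 0) (by
    intro f hf
    set C : Finset V := {u | f u = 1 ∧ u ≠ v ∧ ¬ G.Adj v u} with hCdef
    have hCmem : ∀ u, u ∈ C ↔ f u = 1 ∧ u ≠ v ∧ ¬ G.Adj v u := by intro u; simp [hCdef]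
    have hclosed : ∀ u ∈ C, ∀ w, G.Adj u w → w ∈ C ∨ G.Adj v w := by
      intro u hu w huw
      rw [hCmem] at hu
      by_cases hvw : G.Adj v w
      · exact Or.inr hvw
      refine Or.inl ((hCmem w).2 ⟨?_, fun h => hu.2.2 (h ▸ huw.symm), hvw⟩)
      rw [← hu.1]
      by_cases hAu : A u
      · exact (hf (u, w) ((hEmem _).2 ⟨huw, hAu, hu.2.1⟩) (by simp [hS, hvw])).symm
      · exact hf (w, u) ((hEmem _).2 ⟨huw.symm, (hA _ _ huw.symm).2 hAu,
          fun h => hu.2.2 ((show w = v from h) ▸ huw.symm)⟩) (by simp [hS, hu.2.2])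
    have hcp : cutPairs G C = {p ∈ S | f p.1 = 1} := by
      ext ⟨a, b⟩
      simp only [cutPairs, hS, mem_filter, mem_univ, true_and, hEmem]
      constructor
      · rintro ⟨hab, ha, hb⟩
        have hvb := (hclosed a ha b hab).resolve_left hb
        exact ⟨⟨⟨hab, (hA _ _ hab).2 ((hA _ _ hvb).1 hv), ((hCmem a).1 ha).2.1⟩, hvb⟩,
          ((hCmem a).1 ha).1⟩
      · rintro ⟨⟨⟨hab, hAa, hav⟩, hvb⟩, hfa⟩
        exact ⟨hab, (hCmem a).2 ⟨hfa, hav, fun h => (hA _ _ h).1 hv hAa⟩,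
          fun h => ((hCmem b).1 h).2.2 hvb⟩
    have hind : ∀ z : ZMod 2, z = if z = 1 then 1 else 0 := by decide
    have h1 : ∑ u, f u * (if A u ∧ u ≠ v then 1 else 0) = ((#{u ∈ C | A u} : ℕ) : ZMod 2) := by
      rw [Finset.card_filter, Nat.cast_sum, hCdef, Finset.sum_filter]
      refine Finset.sum_congr rfl fun u _ => ?_
      have hadj : A u → ¬ G.Adj v u := fun h h' => (hA _ _ h').1 hv h
      conv_lhs => rw [hind (f u)]
      by_cases hAu : A u
      · have := hadj hAu
        by_cases hfu : f u = 1 <;> by_cases huv : u = v <;> simp [hAu, hfu, huv, this]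
      · simp [hAu]
    have h2 : ∑ p ∈ S, f p.2 = 0 := by
      rw [← Finset.sum_fiberwise_of_maps_to (g := Prod.snd) (t := {y | G.Adj v y})
        (by intro p hp; simpa using (Finset.mem_filter.1 hp).2)]
      refine Finset.sum_eq_zero fun y hy => ?_
      rw [Finset.sum_congr rfl (g := fun _ => f y) fun p hp => by
        rw [(Finset.mem_filter.1 hp).2], Finset.sum_const, hSfib y (by simpa using hy), two_nsmul,
        CharTwo.add_self_eq_zero]
    have h3 : ∑ p ∈ S, f p.1 = ((#(cutPairs G C) : ℕ) : ZMod 2) := by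
      rw [hcp, Finset.card_filter, Nat.cast_sum]
      refine Finset.sum_congr rfl fun p _ => ?_
      conv_lhs => rw [hind (f p.1)]
      push_cast
      rfl
    rw [Finset.sum_add_distrib, h1, h2, h3, add_zero]
    have hnot : ¬ Odd (#{u ∈ C | A u} + #(cutPairs G C)) := fun hodd =>
      hC C ⟨by simp [hCmem], fun u hu => ((hCmem u).1 hu).2.2, hclosed, hodd⟩
    rw [Nat.not_odd_iff_even, ← ZMod.natCast_eq_zero_iff_even, Nat.cast_add] at hnot
    exact CharTwo.add_eq_zero.1 hnot)
  refine ⟨R, hRE, fun y hy => ?_, hR⟩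
  obtain ⟨p, hp⟩ := Finset.card_pos.1 (by rw [hSfib y hy]; norm_num : 0 < #{p ∈ S | p.2 = y})
  rw [Finset.mem_filter] at hp
  exact ⟨p, hSR hp.1, hp.2⟩

/-- The union of the remaining components is an obstruction as well, and together the two send six
edges to the neighbours of `v`. -/
theorem IsParityObstruction.compl {V : Type*} [Fintype V] {G : SimpleGraph V} {A : V → Prop}
    {v : V} {C : Finset V} (h : IsParityObstruction G A v C)
    (hA : ∀ u w, G.Adj u w → (A u ↔ ¬ A w)) (hv : A v) (hcub : ∀ u, #{x | G.Adj u x} = 3)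
    (hodd : Odd #{u | A u}) :
    IsParityObstruction G A v ({u | u ≠ v ∧ ¬ G.Adj v u ∧ u ∉ C} : Finset V) ∧
      #(cutPairs G C) + #(cutPairs G ({u | u ≠ v ∧ ¬ G.Adj v u ∧ u ∉ C} : Finset V)) = 6 := by
  set D : Finset V := {u | u ≠ v ∧ ¬ G.Adj v u ∧ u ∉ C} with hD
  have hDmem : ∀ u, u ∈ D ↔ u ≠ v ∧ ¬ G.Adj v u ∧ u ∉ C := by intro u; simp [hD]
  have hclosed : ∀ u ∈ D, ∀ w, G.Adj u w → w ∈ D ∨ G.Adj v w := by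
    intro u hu w huw
    rw [hDmem] at hu
    by_cases hvw : G.Adj v w
    · exact Or.inr hvw
    refine Or.inl ((hDmem w).2 ⟨fun hw => hu.2.1 (hw ▸ huw.symm), hvw, fun hw => ?_⟩)
    rcases h.closed w hw u huw.symm with h' | h'
    · exact hu.2.2 h'
    · exact hu.2.1 h'
  have hsix : #(cutPairs G C) + #(cutPairs G D) = 6 := by
    rw [← Finset.card_union_of_disjoint (by
      rw [Finset.disjoint_left]
      intro p hp hp'
      simp only [cutPairs, mem_filter, mem_univ, true_and] at hp hp'
      exact ((hDmem _).1 hp'.2.1).2.2 hp.2.1)]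
    have : cutPairs G C ∪ cutPairs G D = {p ∈ edgesAvoiding G A v | G.Adj v p.2} := by
      ext ⟨a, b⟩
      simp only [cutPairs, edgesAvoiding, mem_union, mem_filter, mem_univ, true_and]
      constructor
      · rintro (⟨hab, ha, hb⟩ | ⟨hab, ha, hb⟩)
        · have hvb := (h.closed a ha b hab).resolve_left hb
          exact ⟨⟨hab, (hA _ _ hab).2 ((hA _ _ hvb).1 hv), fun hav =>
            h.notMem ((show a = v from hav) ▸ ha)⟩, hvb⟩
        · have hvb := (hclosed a ha b hab).resolve_left hb
          exact ⟨⟨hab, (hA _ _ hab).2 ((hA _ _ hvb).1 hv), ((hDmem a).1 ha).1⟩, hvb⟩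
      · rintro ⟨⟨hab, hAa, hav⟩, hvb⟩
        by_cases haC : a ∈ C
        · exact Or.inl ⟨hab, haC, fun hb => h.not_adj b hb hvb⟩
        · exact Or.inr ⟨hab, (hDmem a).2 ⟨hav, fun hva => (hA _ _ hva).1 hv hAa, haC⟩,
            fun hb => ((hDmem b).1 hb).2.1 hvb⟩
    rw [this, Finset.card_eq_sum_card_fiberwise (f := Prod.snd) (t := {y | G.Adj v y})
      (by intro p hp; simpa using (Finset.mem_filter.1 hp).2),
      Finset.sum_congr rfl (g := fun _ => 2), Finset.sum_const, hcub]
    · rfl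
    · intro y hy
      have hy : G.Adj v y := by simpa using hy
      have h1 := card_edgesAvoiding_snd_add_one G A v hA hv hy
      rw [hcub] at h1
      have : ({p ∈ {p ∈ edgesAvoiding G A v | G.Adj v p.2} | p.2 = y} : Finset (V × V)) =
          {p ∈ edgesAvoiding G A v | p.2 = y} := by
        ext p
        simp only [mem_filter]
        constructor
        · rintro ⟨⟨h1, -⟩, h2⟩; exact ⟨h1, h2⟩
        · rintro ⟨h1, h2⟩; exact ⟨⟨h1, h2 ▸ hy⟩, h2⟩
      rw [this]
      omega
  refine ⟨⟨by simp [hDmem], fun u hu => ((hDmem u).1 hu).2.1, hclosed, ?_⟩, hsix⟩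
  have hsplit : #{u | A u} = #{u ∈ C | A u} + #{u ∈ D | A u} + 1 := by
    rw [← Finset.card_union_of_disjoint (by
      rw [Finset.disjoint_left]
      intro u hu hu'
      exact ((hDmem u).1 (Finset.mem_filter.1 hu').1).2.2 (Finset.mem_filter.1 hu).1),
      ← Finset.card_insert_of_notMem (a := v) (by simp [hDmem, h.notMem])]
    congr 1
    ext u
    have hadj : A u → ¬ G.Adj v u := fun h h' => (hA _ _ h').1 hv h
    simp only [mem_filter, mem_univ, true_and, mem_insert, mem_union, hDmem]
    by_cases huv : u = v
    · subst huv; simp [hv]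
    · tauto
  have := h.odd
  rw [Nat.odd_iff] at *
  omega

theorem exists_edges_of_cubic {V : Type*} [Fintype V] (G : SimpleGraph V) (A : V → Prop)
    (hA : ∀ u w, G.Adj u w → (A u ↔ ¬ A w)) (hcub : ∀ u, #{x | G.Adj u x} = 3)
    (hcut : ∀ (C : Finset V) (a b : V), a ∈ C → b ∉ C →
      3 ≤ #{p : V × V | G.Adj p.1 p.2 ∧ p.1 ∈ C ∧ p.2 ∉ C})
    (hodd : Odd #{u | A u}) :
    ∃ v, A v ∧ ∃ R ⊆ edgesAvoiding G A v, (∀ y, G.Adj v y → ∃ p ∈ R, p.2 = y) ∧ ∀ u,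
      ((#{p ∈ R | p.1 = u} + #{p ∈ R | p.2 = u} : ℕ) : ZMod 2) = if A u ∧ u ≠ v then 1 else 0 := by
  by_contra hcon
  have hbad : ∀ v, A v → ∃ C, IsParityObstruction G A v C := by
    intro v hv
    by_contra hC
    exact hcon ⟨v, hv, exists_edges_of_no_obstruction G A v hA hv hcub (not_exists.1 hC)⟩
  have hex : ({q | A q.1 ∧ IsParityObstruction G A q.1 q.2} : Finset (V × Finset V)).Nonempty := by
    obtain ⟨v, hv⟩ := Finset.card_pos.1 hodd.pos
    have hv : A v := by simpa using hv
    obtain ⟨C, hC⟩ := hbad v hv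
    exact ⟨(v, C), by simpa using ⟨hv, hC⟩⟩
  obtain ⟨⟨v, C⟩, hvC, hmin⟩ := Finset.exists_min_image _ (fun q => #q.2) hex
  simp only [mem_filter, mem_univ, true_and, Prod.forall, and_imp] at hvC hmin
  obtain ⟨hv, hC⟩ := hvC
  have hne : ∀ {v C}, IsParityObstruction G A v C → 3 ≤ #(cutPairs G C) := by
    intro v C h
    rcases C.eq_empty_or_nonempty with rfl | ⟨a, ha⟩
    · simpa [cutPairs] using h.odd
    · exact hcut C a v ha h.notMem
  obtain ⟨hC', hsix⟩ := hC.compl hA hv hcub hodd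
  have hthree : #(cutPairs G C) = 3 := by
    have := hne hC
    have := hne hC'
    omega
  have heven : Even #{u ∈ C | A u} := by
    have := hC.odd
    rw [hthree] at this
    rw [Nat.even_iff]
    rw [Nat.odd_iff] at this
    omega
  obtain ⟨⟨c, y⟩, hcy⟩ := Finset.card_pos.1 (by omega : 0 < #(cutPairs G C))
  simp only [cutPairs, mem_filter, mem_univ, true_and] at hcy
  obtain ⟨hcy, hcC, hyC⟩ := hcy
  have hvy := (hC.closed c hcC y hcy).resolve_left hyC
  have hAc : A c := (hA _ _ hcy).2 ((hA _ _ hvy).1 hv)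
  have hcv : c ≠ v := fun h => hC.notMem (h ▸ hcC)
  obtain ⟨D, hD, hvD⟩ : ∃ D, IsParityObstruction G A c D ∧ v ∉ D := by
    obtain ⟨D, hD⟩ := hbad c hAc
    by_cases hvD : v ∈ D
    · exact ⟨_, (hD.compl hA hAc hcub hodd).1, by simp [hvD]⟩
    · exact ⟨D, hD, hvD⟩
  have hDY : ∀ u ∈ D, ¬ G.Adj v u := by
    intro u hu huv
    rcases hD.closed u hu v huv.symm with h | h
    · exact hvD h
    · exact (hA _ _ h).1 hAc hv
  have hDC : D ⊆ C := by
    intro u₀ hu₀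
    by_contra hu₀C
    set Q : Finset V := {u ∈ D | u ∉ C} with hQ
    have hQcut : ∀ p ∈ cutPairs G Q, p.1 ∉ C ∧ p.1 ≠ v ∧ G.Adj p.1 p.2 ∧
        G.Adj c p.2 ∧ G.Adj v p.2 := by
      rintro ⟨a, b⟩ hp
      simp only [cutPairs, hQ, mem_filter, mem_univ, true_and, not_and, not_not] at hp
      obtain ⟨hab, ⟨haD, haC⟩, hb⟩ := hp
      have hbC : b ∉ C := by
        intro hbC
        rcases hC.closed b hbC a hab.symm with h | h
        · exact haC h
        · exact hDY a haD h
      have hcb := (hD.closed a haD b hab).resolve_left fun h => hbC (hb h)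
      exact ⟨haC, fun h => hvD ((show a = v from h) ▸ haD), hab, hcb,
        (hC.closed c hcC b hcb).resolve_left hbC⟩
    have h3 : 3 ≤ #(cutPairs G Q) := hcut Q u₀ v (by simp [hQ, hu₀, hu₀C]) (by simp [hQ, hvD])
    set Z : Finset V := {b | G.Adj c b ∧ G.Adj v b} with hZ
    have hle : #(cutPairs G Q) ≤ #Z := by
      refine Finset.card_le_card_of_injOn Prod.snd
        (fun p hp => by simpa [hZ] using (hQcut p hp).2.2.2) ?_
      rintro ⟨a, b⟩ hp ⟨a', b'⟩ hp' hbb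
      obtain rfl : b = b' := hbb
      obtain ⟨h1, h2, h3, h4, h5⟩ := hQcut _ hp
      obtain ⟨h1', h2', h3', -, -⟩ := hQcut _ hp'
      by_contra hne
      have haa : a ≠ a' := fun h => hne (by rw [h])
      have hac : a ≠ c := fun h => h1 (h ▸ hcC)
      have hac' : a' ≠ c := fun h => h1' (h ▸ hcC)
      have hsub : ({a, a', v, c} : Finset V) ⊆ ({x | G.Adj b x} : Finset V) := by
        intro x hx
        simp only [mem_insert, mem_singleton] at hx
        rcases hx with rfl | rfl | rfl | rfl
        · simpa using h3.symm
        · simpa using h3'.symm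
        · simpa using h5.symm
        · simpa using h4.symm
      have hfour : #({a, a', v, c} : Finset V) = 4 := by
        rw [Finset.card_insert_of_notMem, Finset.card_insert_of_notMem, Finset.card_pair hcv.symm]
        · simpa using ⟨h2', hac'⟩
        · simpa using ⟨haa, h2, hac⟩
      have := Finset.card_le_card hsub
      rw [hfour, hcub] at this
      omega
    have hZv : Z = ({b | G.Adj v b} : Finset V) :=
      Finset.eq_of_subset_of_card_le (fun b hb => by simpa using (Finset.mem_filter.1 hb).2.2)
        (by rw [hcub]; omega)
    have hZc : Z = ({b | G.Adj c b} : Finset V) :=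
      Finset.eq_of_subset_of_card_le (fun b hb => by simpa using (Finset.mem_filter.1 hb).2.1)
        (by rw [hcub]; omega)
    have hcv_iff : ∀ b, G.Adj c b ↔ G.Adj v b := by
      intro b
      have := congrArg (b ∈ ·) (hZc.symm.trans hZv)
      simpa using this
    have hcutC : Z.map ⟨fun b => (c, b), fun a b h => (Prod.mk.inj h).2⟩ = cutPairs G C := by
      refine Finset.eq_of_subset_of_card_le ?_ (by rw [Finset.card_map, hthree]; omega)
      intro p hp
      obtain ⟨b, hb, rfl⟩ := Finset.mem_map.1 hp
      have hb := (Finset.mem_filter.1 hb).2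
      exact Finset.mem_filter.2 ⟨mem_univ _, hb.1, hcC, fun h => hC.not_adj b h hb.2⟩
    have hCc : C = {c} := by
      by_contra hCne
      obtain ⟨a, haC, hac⟩ : ∃ a ∈ C, a ≠ c := by
        by_contra! hall
        exact hCne (Finset.eq_singleton_iff_unique_mem.2 ⟨hcC, hall⟩)
      have hcut' := hcut (C.erase c) a c (by simp [haC, hac]) (by simp)
      obtain ⟨⟨a, b⟩, hp⟩ := Finset.card_pos.1 (lt_of_lt_of_le (by norm_num) hcut')
      simp only [mem_filter, mem_univ, true_and, mem_erase, not_and] at hp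
      obtain ⟨hab, ⟨hac, haC⟩, hb⟩ := hp
      by_cases hbc : b = c
      · subst hbc
        exact hC.not_adj a haC ((hcv_iff a).1 hab.symm)
      · have : (a, b) ∈ cutPairs G C := Finset.mem_filter.2 ⟨mem_univ _, hab, haC, hb hbc⟩
        rw [← hcutC, Finset.mem_map] at this
        obtain ⟨_, -, h⟩ := this
        exact hac (Prod.mk.inj h).1.symm
    rw [hCc, Finset.filter_singleton, if_pos hAc] at heven
    simp at heven
  have hlt : #D < #C :=
    Finset.card_lt_card ⟨hDC, fun h => hD.notMem (h hcC)⟩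
  exact absurd (hmin c D hAc hD) (by omega)

/-- The number of pairs in `R` that contain `u`. -/
noncomputable def pairDegree {V : Type*} (R : Finset (V × V)) (u : V) : ℕ :=
  #{p ∈ R | p.1 = u} + #{p ∈ R | p.2 = u}

/-- The weight `1` on the pairs of `R` and `0` elsewhere. -/
noncomputable def pairWeight {V : Type*} (R : Finset (V × V)) : Sym2 V → ℕ :=
  Sym2.lift ⟨fun x y => if (x, y) ∈ R ∨ (y, x) ∈ R then 1 else 0, fun x y => by
    simp only [or_comm]⟩

theorem pairWeight_eq_zero_or_one {V : Type*} (R : Finset (V × V)) (e : Sym2 V) :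
    pairWeight R e = 0 ∨ pairWeight R e = 1 := by
  induction e with
  | _ x y =>
    simp only [pairWeight, Sym2.lift_mk]
    split_ifs <;> simp

theorem wdeg_pairWeight {V : Type} [Fintype V] (G : SimpleGraph V) (A : V → Prop)
    (hA : ∀ u w, G.Adj u w → (A u ↔ ¬ A w)) (R : Finset (V × V))
    (hR : ∀ p ∈ R, G.Adj p.1 p.2 ∧ A p.1) (u : V) :
    wdeg G (pairWeight R) u = pairDegree R u := by
  have hfst : #{p ∈ R | p.1 = u} = #{x | (u, x) ∈ R} := by
    refine Finset.card_nbij' Prod.snd (fun x => (u, x)) ?_ ?_ ?_ ?_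
    · rintro ⟨a, b⟩ h; simp at h ⊢; exact h.2 ▸ h.1
    · intro x h; simpa using h
    · rintro ⟨a, b⟩ h; simp at h ⊢; exact h.2.symm
    · intro x _; rfl
  have hsnd : #{p ∈ R | p.2 = u} = #{x | (x, u) ∈ R} := by
    refine Finset.card_nbij' Prod.fst (fun x => (x, u)) ?_ ?_ ?_ ?_
    · rintro ⟨a, b⟩ h; simp at h ⊢; exact h.2 ▸ h.1
    · intro x h; simpa using h
    · rintro ⟨a, b⟩ h; simp at h ⊢; exact h.2.symm
    · intro x _; rfl
  rw [pairDegree, hfst, hsnd, Finset.card_filter, Finset.card_filter, ← Finset.sum_add_distrib,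
    wdeg, Finset.sum_filter]
  refine Finset.sum_congr rfl fun x _ => ?_
  simp only [pairWeight, Sym2.lift_mk]
  by_cases h1 : (u, x) ∈ R
  · have h2 : (x, u) ∉ R := fun h2 => (hA _ _ (hR _ h1).1).1 (hR _ h1).2 (hR _ h2).2
    simp [h1, h2, (hR _ h1).1]
  · by_cases h2 : (x, u) ∈ R
    · simp [h1, h2, (hR _ h2).1.symm]
    · simp [h1, h2]

theorem hasZeroOneProperty_of_pairDegree {V : Type} [Fintype V] (G : SimpleGraph V) (A : V → Prop)
    (hA : ∀ u w, G.Adj u w → (A u ↔ ¬ A w)) (R : Finset (V × V))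
    (hR : ∀ p ∈ R, G.Adj p.1 p.2 ∧ A p.1)
    (hne : ∀ u w, G.Adj u w → A u → pairDegree R u ≠ pairDegree R w) :
    HasZeroOneProperty G := by
  refine ⟨pairWeight R, fun e _ => pairWeight_eq_zero_or_one R e, fun u w huw => ?_⟩
  rw [wdeg_pairWeight G A hA R hR, wdeg_pairWeight G A hA R hR]
  by_cases h : A u
  · exact hne u w huw h
  · exact (hne w u huw.symm ((hA _ _ huw.symm).2 h)).symm

theorem hasABProperty_of_pairDegree {V : Type} [Fintype V] (G : SimpleGraph V) (A : V → Prop)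
    (hA : ∀ u w, G.Adj u w → (A u ↔ ¬ A w)) (R : Finset (V × V))
    (hR : ∀ p ∈ R, G.Adj p.1 p.2 ∧ A p.1)
    (hne : ∀ u w, G.Adj u w → A u →
      #{x | G.Adj u x} + pairDegree R u ≠ #{x | G.Adj w x} + pairDegree R w) :
    HasABProperty G 1 2 := by
  refine ⟨fun e => 1 + (pairWeight R e : ℤ), fun e _ => ?_, fun u w huw => ?_⟩
  · rcases pairWeight_eq_zero_or_one R e with h | h <;> simp [h]
  have key : ∀ u, wdegZ G (fun e => 1 + (pairWeight R e : ℤ)) u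
      = ((#{x | G.Adj u x} + pairDegree R u : ℕ) : ℤ) := by
    intro u
    rw [← wdeg_pairWeight G A hA R hR, wdegZ, wdeg, Finset.sum_add_distrib]
    simp
  rw [key, key, Ne, Nat.cast_inj]
  by_cases h : A u
  · exact hne u w huw h
  · exact (hne w u huw.symm ((hA _ _ huw.symm).2 h)).symm

theorem sum_card_adj_eq_zero {V : Type*} [Fintype V] (G : SimpleGraph V) :
    ∑ u, ((#{x | G.Adj u x} : ℕ) : ZMod 2) = 0 := by
  rw [← Nat.cast_sum, ZMod.natCast_eq_zero_iff_even]
  have h := G.sum_degrees_eq_twice_card_edges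
  simp only [← SimpleGraph.card_neighborFinset_eq_degree, SimpleGraph.neighborFinset_eq_filter] at h
  exact ⟨_, (h.trans (two_mul _))⟩

theorem sum_indicator_eq_zero_of_even {V : Type*} [Fintype V] (A : V → Prop)
    (hA : Even #{u | A u}) : ∑ u, (if A u then 1 else 0 : ZMod 2) = 0 := by
  rw [Finset.sum_boole, ZMod.natCast_eq_zero_iff_even]
  exact hA

theorem sum_indicator_ne_eq_zero_of_odd {V : Type*} [Fintype V] (A : V → Prop) {v : V} (hv : A v)
    (hA : Odd #{u | A u}) : ∑ u, (if A u ∧ u ≠ v then 1 else 0 : ZMod 2) = 0 := by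
  rw [Finset.sum_boole, ZMod.natCast_eq_zero_iff_even]
  have h : ({u | A u ∧ u ≠ v} : Finset V) = ({u | A u} : Finset V).erase v := by
    ext u; simp [and_comm]
  rw [h, Finset.card_erase_of_mem (by simpa using hv)]
  exact Nat.Odd.sub_odd hA odd_one

theorem eq_of_forall_adj {V : Type*} {G : SimpleGraph V} (hG : G.Connected) {α : Type*} {f : V → α}
    (hf : ∀ u w, G.Adj u w → f u = f w) (u w : V) : f u = f w := by
  obtain ⟨p⟩ := hG.preconnected u w
  induction p with
  | nil => rfl
  | cons h _ ih => exact (hf _ _ h).trans ih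

/-- A connected graph with a bipartition admits a set of edges with prescribed degree parities,
provided that these sum to zero. -/
theorem exists_edges_of_connected {V : Type*} [Fintype V] (G : SimpleGraph V) (A : V → Prop)
    (hA : ∀ u w, G.Adj u w → (A u ↔ ¬ A w)) (hG : G.Connected) (T : V → ZMod 2)
    (hT : ∑ u, T u = 0) :
    ∃ R : Finset (V × V), (∀ p ∈ R, G.Adj p.1 p.2 ∧ A p.1) ∧
      ∀ u, (pairDegree R u : ZMod 2) = T u := by
  obtain ⟨R, hRE, -, hR⟩ := exists_edges_with_parities
    ({p | G.Adj p.1 p.2 ∧ A p.1} : Finset (V × V)) ∅ (Finset.empty_subset _) T (by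
      intro f hf
      have hadj : ∀ u w, G.Adj u w → f u = f w := by
        intro u w huw
        by_cases h : A u
        · exact hf (u, w) (by simp [huw, h]) (by simp)
        · exact (hf (w, u) (by simp [huw.symm, (hA _ _ huw.symm).2 h]) (by simp)).symm
      obtain ⟨a⟩ := hG.nonempty
      rw [Finset.sum_congr rfl (g := fun u => f a * T u) fun u _ => by
        rw [eq_of_forall_adj hG hadj u a], ← Finset.mul_sum, hT]
      simp)
  exact ⟨R, fun p hp => by simpa using hRE hp, hR⟩

theorem properties_of_even {V : Type} [Fintype V] (G : SimpleGraph V) (A : V → Prop)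
    (hA : ∀ u w, G.Adj u w → (A u ↔ ¬ A w)) (hG : G.Connected) (heven : Even #{u | A u}) :
    HasZeroOneProperty G ∧ HasABProperty G 1 2 := by
  constructor
  · obtain ⟨R, hR, hT⟩ := exists_edges_of_connected G A hA hG (fun u => if A u then 1 else 0)
      (sum_indicator_eq_zero_of_even A heven)
    refine hasZeroOneProperty_of_pairDegree G A hA R hR fun u w huw hu heq => ?_
    have := congrArg (Nat.cast : ℕ → ZMod 2) heq
    rw [hT, hT, if_pos hu, if_neg ((hA _ _ huw).1 hu)] at this
    exact one_ne_zero this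
  · obtain ⟨R, hR, hT⟩ := exists_edges_of_connected G A hA hG
      (fun u => ((#{x | G.Adj u x} : ℕ) : ZMod 2) + if A u then 1 else 0)
      (by rw [Finset.sum_add_distrib, sum_card_adj_eq_zero, sum_indicator_eq_zero_of_even A heven,
        add_zero])
    refine hasABProperty_of_pairDegree G A hA R hR fun u w huw hu heq => ?_
    have := congrArg (Nat.cast : ℕ → ZMod 2) heq
    rw [Nat.cast_add, Nat.cast_add, hT, hT, if_pos hu, if_neg ((hA _ _ huw).1 hu), ← add_assoc,
      ← add_assoc, CharTwo.add_self_eq_zero, CharTwo.add_self_eq_zero, add_zero, zero_add] at this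
    exact one_ne_zero this

theorem pairDegree_eq_zero {V : Type*} [Fintype V] {G : SimpleGraph V} {A : V → Prop} {v : V}
    (hA : ∀ u w, G.Adj u w → (A u ↔ ¬ A w)) (hv : A v) {R : Finset (V × V)}
    (hR : R ⊆ edgesAvoiding G A v) : pairDegree R v = 0 := by
  have hmem : ∀ p ∈ R, G.Adj p.1 p.2 ∧ A p.1 ∧ p.1 ≠ v := by
    intro p hp; simpa [edgesAvoiding] using hR hp
  rw [pairDegree, Nat.add_eq_zero_iff, Finset.card_eq_zero, Finset.card_eq_zero,
    Finset.filter_eq_empty_iff, Finset.filter_eq_empty_iff]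
  exact ⟨fun p hp => (hmem p hp).2.2, fun p hp h =>
    (hA _ _ (hmem p hp).1).1 (hmem p hp).2.1 (h ▸ hv)⟩

theorem pairDegree_pos {V : Type*} {R : Finset (V × V)} {y : V} (h : ∃ p ∈ R, p.2 = y) :
    0 < pairDegree R y := by
  obtain ⟨p, hp, rfl⟩ := h
  exact Nat.add_pos_right _ (Finset.card_pos.2 ⟨p, by simpa using hp⟩)

theorem hasZeroOneProperty_of_edgesAvoiding {V : Type} [Fintype V] (G : SimpleGraph V)
    (A : V → Prop) {v : V} (hA : ∀ u w, G.Adj u w → (A u ↔ ¬ A w)) (hv : A v)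
    {R : Finset (V × V)} (hR : R ⊆ edgesAvoiding G A v)
    (hnbr : ∀ y, G.Adj v y → ∃ p ∈ R, p.2 = y)
    (hT : ∀ u, (pairDegree R u : ZMod 2) = if A u ∧ u ≠ v then 1 else 0) :
    HasZeroOneProperty G := by
  refine hasZeroOneProperty_of_pairDegree G A hA R
    (fun p hp => by have := hR hp; simp [edgesAvoiding] at this; exact ⟨this.1, this.2.1⟩)
    fun u w huw hu heq => ?_
  rcases eq_or_ne u v with rfl | huv
  · rw [pairDegree_eq_zero hA hv hR] at heq
    exact (pairDegree_pos (hnbr w huw)).ne heq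
  · have := congrArg (Nat.cast : ℕ → ZMod 2) heq
    rw [hT, hT, if_pos ⟨hu, huv⟩, if_neg fun h => (hA _ _ huw).1 hu h.1] at this
    exact one_ne_zero this

theorem hasABProperty_of_edgesAvoiding {V : Type} [Fintype V] (G : SimpleGraph V)
    (A : V → Prop) {v : V} (hA : ∀ u w, G.Adj u w → (A u ↔ ¬ A w)) (hv : A v)
    (hmin : ∀ y, G.Adj v y → #{x | G.Adj v x} ≤ #{x | G.Adj y x})
    {R : Finset (V × V)} (hR : R ⊆ edgesAvoiding G A v)
    (hnbr : ∀ y, G.Adj v y → ∃ p ∈ R, p.2 = y) (c : ZMod 2)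
    (hT : ∀ u, u ≠ v → (pairDegree R u : ZMod 2) =
      ((#{x | G.Adj u x} : ℕ) : ZMod 2) + c + if A u then 1 else 0) :
    HasABProperty G 1 2 := by
  refine hasABProperty_of_pairDegree G A hA R
    (fun p hp => by have := hR hp; simp [edgesAvoiding] at this; exact ⟨this.1, this.2.1⟩)
    fun u w huw hu heq => ?_
  rcases eq_or_ne u v with rfl | huv
  · rw [pairDegree_eq_zero hA hv hR] at heq
    have h1 := pairDegree_pos (hnbr w huw)
    have h2 := hmin w huw
    omega
  · have hw := (hA _ _ huw).1 hu
    have := congrArg (Nat.cast : ℕ → ZMod 2) heq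
    rw [Nat.cast_add, Nat.cast_add, hT u huv, hT w (fun h => hw (h ▸ hv)), if_pos hu, if_neg hw,
      ← add_assoc, ← add_assoc, ← add_assoc, ← add_assoc, CharTwo.add_self_eq_zero,
      CharTwo.add_self_eq_zero, add_zero, zero_add] at this
    exact one_ne_zero (left_eq_add.1 this.symm)

theorem properties_of_not_cubic {V : Type} [Fintype V] (G : SimpleGraph V) (A : V → Prop) (v : V)
    (hA : ∀ u w, G.Adj u w → (A u ↔ ¬ A w)) (hv : A v)
    (hconn : (G.induce {x | x ≠ v}).Connected)
    (hcut : ∀ (C : Finset V) (a b : V), a ∈ C → b ∉ C →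
      3 ≤ #{p : V × V | G.Adj p.1 p.2 ∧ p.1 ∈ C ∧ p.2 ∉ C})
    (h3 : 3 ≤ #{x | G.Adj v x})
    (hmin : ∀ y, G.Adj v y → #{x | G.Adj v x} ≤ #{x | G.Adj y x})
    (hex : #{x | G.Adj v x} = 3 → ∃ y, G.Adj v y ∧ 3 < #{x | G.Adj y x})
    (hodd : Odd #{u | A u}) (hodd' : Odd #{u | ¬ A u}) :
    HasZeroOneProperty G ∧ HasABProperty G 1 2 := by
  constructor
  · obtain ⟨R, hR, hnbr, hT⟩ := exists_edges_of_not_cubic G A v hA hv hconn hcut h3 hmin hex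
      (fun u => if A u ∧ u ≠ v then 1 else 0) (by simp)
      (sum_indicator_ne_eq_zero_of_odd A hv hodd)
    exact hasZeroOneProperty_of_edgesAvoiding G A hA hv hR hnbr hT
  · set c : ZMod 2 := ((#{x | G.Adj v x} : ℕ) : ZMod 2) with hc
    have hV : Even (Fintype.card V) := by
      rw [← Finset.card_univ, ← Finset.card_filter_add_card_filter_not (p := A)]
      exact hodd.add_odd hodd'
    obtain ⟨R, hR, hnbr, hT⟩ := exists_edges_of_not_cubic G A v hA hv hconn hcut h3 hmin hex
      (fun u => ((#{x | G.Adj u x} : ℕ) : ZMod 2) + c + if A u ∧ u ≠ v then 1 else 0)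
      (by simp [hc, CharTwo.add_self_eq_zero])
      (by
        rw [Finset.sum_add_distrib, Finset.sum_add_distrib, sum_card_adj_eq_zero,
          sum_indicator_ne_eq_zero_of_odd A hv hodd, Finset.sum_const, Finset.card_univ,
          nsmul_eq_mul, (ZMod.natCast_eq_zero_iff_even).2 hV]
        simp)
    refine hasABProperty_of_edgesAvoiding G A hA hv hmin hR hnbr c fun u hu => ?_
    simpa [hu, pairDegree] using hT u

theorem properties_of_cubic {V : Type} [Fintype V] (G : SimpleGraph V) (A : V → Prop)
    (hA : ∀ u w, G.Adj u w → (A u ↔ ¬ A w)) (hcub : ∀ u, #{x | G.Adj u x} = 3)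
    (hcut : ∀ (C : Finset V) (a b : V), a ∈ C → b ∉ C →
      3 ≤ #{p : V × V | G.Adj p.1 p.2 ∧ p.1 ∈ C ∧ p.2 ∉ C})
    (hodd : Odd #{u | A u}) :
    HasZeroOneProperty G ∧ HasABProperty G 1 2 := by
  obtain ⟨v, hv, R, hR, hnbr, hT⟩ := exists_edges_of_cubic G A hA hcub hcut hodd
  refine ⟨hasZeroOneProperty_of_edgesAvoiding G A hA hv hR hnbr hT,
    hasABProperty_of_edgesAvoiding G A hA hv (fun y _ => by rw [hcub, hcub]) hR hnbr 1
      fun u hu => ?_⟩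
  have h31 : ((3 : ℕ) : ZMod 2) + 1 = 0 := by decide
  rw [hcub, h31, zero_add]
  simpa [hu, pairDegree] using hT u

theorem properties_of_odd {V : Type} [Fintype V] (G : SimpleGraph V) (A : V → Prop)
    (hA : ∀ u w, G.Adj u w → (A u ↔ ¬ A w)) (hG : G.Connected)
    (h2conn : ∀ v : V, (G.induce {x : V | x ≠ v}).Connected)
    (hcut : ∀ (C : Finset V) (a b : V), a ∈ C → b ∉ C →
      3 ≤ #{p : V × V | G.Adj p.1 p.2 ∧ p.1 ∈ C ∧ p.2 ∉ C})
    (h3 : ∀ v, 3 ≤ #{x | G.Adj v x})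
    (hodd : Odd #{u | A u}) (hodd' : Odd #{u | ¬ A u}) :
    HasZeroOneProperty G ∧ HasABProperty G 1 2 := by
  by_cases hcub : ∀ u, #{x | G.Adj u x} = 3
  · exact properties_of_cubic G A hA hcub hcut hodd
  obtain ⟨v, hmin, hex⟩ : ∃ v, (∀ y, #{x | G.Adj v x} ≤ #{x | G.Adj y x}) ∧
      (#{x | G.Adj v x} = 3 → ∃ y, G.Adj v y ∧ 3 < #{x | G.Adj y x}) := by
    by_cases h : ∃ v, #{x | G.Adj v x} = 3
    · obtain ⟨v, hv⟩ := h
      by_contra! hno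
      refine hcub fun u => of_eq_true ((eq_of_forall_adj hG (f := fun u => #{x | G.Adj u x} = 3)
        (fun a b hab => propext ?_) u v).trans (eq_true hv))
      have key : ∀ a b, G.Adj a b → #{x | G.Adj a x} = 3 → #{x | G.Adj b x} = 3 := by
        intro a b hab ha
        exact le_antisymm ((hno a fun y => ha ▸ h3 y).2 b hab) (h3 b)
      exact ⟨key a b hab, key b a hab.symm⟩
    · obtain ⟨a⟩ := hG.nonempty
      obtain ⟨v, -, hv⟩ := Finset.exists_min_image Finset.univ (fun v => #{x | G.Adj v x})
        ⟨a, Finset.mem_univ a⟩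
      exact ⟨v, fun y => hv y (Finset.mem_univ y), fun h' => absurd ⟨v, h'⟩ h⟩
  by_cases hv : A v
  · exact properties_of_not_cubic G A v hA hv (h2conn v) hcut (h3 v) (fun y _ => hmin y) hex
      hodd hodd'
  · exact properties_of_not_cubic G (fun u => ¬ A u) v
      (fun u w h => not_congr (hA u w h)) hv (h2conn v) hcut (h3 v) (fun y _ => hmin y) hex
      (by convert hodd') (by simpa using hodd)

/-- Every finite simple bipartite graph which is 2-connected (at least `3`
vertices, and connected after deleting any single vertex) and 3-edge-connected (connected
after deleting any set of at most `2` edges) has both the `{0,1}`- and the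
`{1,2}`-property. -/
theorem statement7 {V : Type} [Fintype V] (G : SimpleGraph V) (hbip : G.Colorable 2)
    (hcard : 3 ≤ Fintype.card V)
    (h2conn : ∀ v : V, (G.induce {x : V | x ≠ v}).Connected)
    (h3edge : ∀ s : Set (Sym2 V), s ⊆ G.edgeSet → s.ncard ≤ 2 →
      (G.deleteEdges s).Connected) :
    HasZeroOneProperty G ∧ HasABProperty G 1 2 := by
  have hG : G.Connected := by simpa using h3edge ∅ (Set.empty_subset _) (by simp)
  obtain ⟨col⟩ := hbip
  set A : V → Prop := fun u => col u = 0 with hAdef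
  have hA : ∀ u w, G.Adj u w → (A u ↔ ¬ A w) := by
    intro u w huw
    have := col.valid huw
    simp only [hAdef]
    omega
  have hA' : ∀ u w, G.Adj u w → (¬ A u ↔ ¬ ¬ A w) := fun u w h => not_congr (hA u w h)
  rcases Nat.even_or_odd #{u | A u} with heven | hodd
  · exact properties_of_even G A hA hG (by convert heven)
  rcases Nat.even_or_odd #{u | ¬ A u} with heven | hodd'
  · exact properties_of_even G (fun u => ¬ A u) hA' hG (by convert heven)
  have hcut : ∀ (C : Finset V) (a b : V), a ∈ C → b ∉ C →
      3 ≤ #{p : V × V | G.Adj p.1 p.2 ∧ p.1 ∈ C ∧ p.2 ∉ C} :=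
    fun C a b ha hb => three_le_card_cut G h3edge C ha hb
  refine properties_of_odd G A hA hG h2conn hcut (fun v => ?_) (by convert hodd) (by convert hodd')
  obtain ⟨b, hb⟩ := Fintype.exists_ne_of_one_lt_card (by omega : 1 < Fintype.card V) v
  refine (hcut {v} v b (by simp) (by simpa using hb)).trans
    (Finset.card_le_card_of_injOn Prod.snd ?_ ?_)
  · rintro ⟨x, y⟩ h
    simp at h ⊢
    exact h.2.1 ▸ h.1
  · rintro ⟨x, y⟩ h ⟨x', y'⟩ h' hyy
    simp at h h' hyy ⊢
    exact ⟨h.2.1.trans h'.2.1.symm, hyy⟩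
end
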